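/- For any sequence w(k) of positive reals with w(k) → ∞ as k → ∞, there exists a Menshov spectrum Λ ⊆ ℤ of the form Λ = {±k² + o(w(k))}; that is, there exist integer sequences (a_k)_{k≥1} and (b_k)_{k≥1} with |a_k − k²| = o(w(k)) and |b_k + k²| = o(w(k)) as k → ∞ such that Λ = {a_k : k ≥ 1} ∪ {b_k : k ≥ 1} is a Menshov spectrum. -/

import Mathlib

open MeasureTheory Filter Topology Real

instance : Fact (0 < 2 * π) := ⟨by positivity⟩

/-- The symmetric partial sum `S_N(t) = ∑_{k ∈ Λ, |k| ≤ N} c_k e^{ikt}` on the circle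
`𝕋 = ℝ/2πℤ`. -/
noncomputable def menshovPartialSum (Λ : Set ℤ) (c : ℤ → ℂ) (N : ℕ)
    (t : AddCircle (2 * π)) : ℂ :=
  ∑ k ∈ Finset.Icc (-(N : ℤ)) (N : ℤ), Λ.indicator c k * fourier k t

/-- A set `Λ ⊆ ℤ` is a Menshov spectrum if every measurable `f : 𝕋 → ℂ` admits a
representation `f(t) = ∑_{k ∈ Λ} c_k e^{ikt}` with symmetric partial sums converging
almost everywhere. -/
def IsMenshovSpectrum (Λ : Set ℤ) : Prop :=
  ∀ f : AddCircle (2 * π) → ℂ, Measurable f → ∃ c : ℤ → ℂ,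
    ∀ᵐ t : AddCircle (2 * π),
      Tendsto (fun N => menshovPartialSum Λ c N t) atTop (𝓝 (f t))

/-- The circle. -/
abbrev Circ := AddCircle (2 * π)

/-- Rudin-Shapiro pairs. -/
lemma rudin_shapiro_pair (m : ℕ) : ∃ p q : ℕ → ℝ,
    (∀ j, p j = 1 ∨ p j = -1) ∧ (∀ j, q j = 1 ∨ q j = -1) ∧
    (∀ v : ℂ, ‖v‖ = 1 →
      ‖∑ j ∈ Finset.range (2 ^ m), (p j : ℂ) * v ^ j‖ ^ 2 +
        ‖∑ j ∈ Finset.range (2 ^ m), (q j : ℂ) * v ^ j‖ ^ 2 = 2 * 2 ^ m ∧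
      ∀ x ≤ 2 ^ m, ‖∑ j ∈ Finset.range x, (p j : ℂ) * v ^ j‖ ≤ 4 * √(2 ^ m) ∧
        ‖∑ j ∈ Finset.range x, (q j : ℂ) * v ^ j‖ ≤ 4 * √(2 ^ m)) := by
  induction m with
  | zero =>
    refine ⟨fun _ => 1, fun _ => 1, by simp, by simp, fun v hv => ⟨by norm_num, ?_⟩⟩
    intro x hx
    have : x = 0 ∨ x = 1 := by omega
    rcases this with rfl | rfl <;> norm_num
  | succ m ih =>
    obtain ⟨p, q, hp, hq, h⟩ := ih
    set N := 2 ^ m with hN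
    have key : ∀ (s : ℝ) (x : ℕ) (v : ℂ),
        ∑ j ∈ Finset.range (N + x), (((if j < N then p j else s * q (j - N) : ℝ)) : ℂ) * v ^ j
        = ∑ j ∈ Finset.range N, (p j : ℂ) * v ^ j
          + s * v ^ N * ∑ j ∈ Finset.range x, (q j : ℂ) * v ^ j := by
      intro s x v
      rw [Finset.sum_range_add, Finset.mul_sum]
      congr 1
      · refine Finset.sum_congr rfl fun j hj => ?_
        rw [if_pos (Finset.mem_range.mp hj)]
      · refine Finset.sum_congr rfl fun j hj => ?_
        rw [if_neg (by omega), Nat.add_sub_cancel_left]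
        push_cast
        ring
    have keylt : ∀ (s : ℝ) (x : ℕ) (v : ℂ), x ≤ N →
        ∑ j ∈ Finset.range x, (((if j < N then p j else s * q (j - N) : ℝ)) : ℂ) * v ^ j
        = ∑ j ∈ Finset.range x, (p j : ℂ) * v ^ j := by
      intro s x v hx
      refine Finset.sum_congr rfl fun j hj => ?_
      rw [if_pos (by have := Finset.mem_range.mp hj; omega)]
    have hsq : √((2:ℝ) ^ (m + 1)) = √2 * √(2 ^ m) := by
      rw [pow_succ, mul_comm, Real.sqrt_mul (by norm_num)]
    have bound : ∀ (s : ℝ), (s = 1 ∨ s = -1) → ∀ v : ℂ, ‖v‖ = 1 → ∀ x ≤ 2 ^ (m + 1),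
        ‖∑ j ∈ Finset.range x, (((if j < N then p j else s * q (j - N) : ℝ)) : ℂ) * v ^ j‖
          ≤ 4 * √(2 ^ (m + 1)) := by
      intro s hs v hv x hx
      have h2 : (1.41 : ℝ) ≤ √2 := by
        apply Real.le_sqrt_of_sq_le; norm_num
      have h3 : √2 ≤ 1.42 := by
        rw [Real.sqrt_le_left (by norm_num)]; norm_num
      have h0 : 0 ≤ √((2:ℝ) ^ m) := Real.sqrt_nonneg _
      rw [hsq]
      rcases le_or_gt x N with hxN | hxN
      · rw [keylt s x v hxN]
        have := ((h v hv).2 x hxN).1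
        nlinarith
      · obtain ⟨y, rfl⟩ := Nat.exists_eq_add_of_lt hxN
        rw [add_assoc, key s (y + 1) v]
        have hy : y + 1 ≤ N := by rw [pow_succ] at hx; omega
        have e1 := ((h v hv).2 (y + 1) hy).2
        have e2 : ‖∑ j ∈ Finset.range N, (p j : ℂ) * v ^ j‖ ≤ √2 * √(2 ^ m) := by
          rw [← Real.sqrt_mul (by norm_num)]
          apply Real.le_sqrt_of_sq_le
          have := (h v hv).1
          nlinarith [sq_nonneg ‖∑ j ∈ Finset.range N, (q j : ℂ) * v ^ j‖]
        have hsn : ‖(s : ℂ)‖ = 1 := by rcases hs with rfl | rfl <;> simp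
        calc _ ≤ ‖∑ j ∈ Finset.range N, (p j : ℂ) * v ^ j‖
              + ‖(s : ℂ) * v ^ N * ∑ j ∈ Finset.range (y + 1), (q j : ℂ) * v ^ j‖ :=
              norm_add_le _ _
          _ ≤ √2 * √(2 ^ m) + 4 * √(2 ^ m) := by
              rw [norm_mul, norm_mul, norm_pow, hv, hsn]
              simpa using add_le_add e2 e1
          _ ≤ _ := by nlinarith
    refine ⟨fun j => if j < N then p j else 1 * q (j - N),
      fun j => if j < N then p j else (-1) * q (j - N), ?_, ?_, ?_⟩
    · intro j
      dsimp only
      split_ifs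
      · exact hp j
      · rw [one_mul]; exact hq _
    · intro j
      dsimp only
      split_ifs
      · exact hp j
      · rcases hq (j - N) with h | h <;> rw [h] <;> norm_num
    · intro v hv
      refine ⟨?_, fun x hx => ⟨bound 1 (Or.inl rfl) v hv x hx, bound (-1) (Or.inr rfl) v hv x hx⟩⟩
      have e : 2 ^ (m + 1) = N + N := by rw [pow_succ]; omega
      rw [e, key, key]
      have := (h v hv).1
      set P := ∑ j ∈ Finset.range N, (p j : ℂ) * v ^ j
      set R := ∑ j ∈ Finset.range N, (q j : ℂ) * v ^ j
      have hR : ‖R‖ = ‖v ^ N * R‖ := by rw [norm_mul, norm_pow, hv]; simp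
      have par := parallelogram_law_with_norm ℝ P (v ^ N * R)
      rw [← hR] at par
      have e1 : P + ((1:ℝ):ℂ) * v ^ N * R = P + v ^ N * R := by push_cast; ring
      have e2 : P + ((-1:ℝ):ℂ) * v ^ N * R = P - v ^ N * R := by push_cast; ring
      rw [e1, e2, par, this]
      ring

/-- Rudin-Shapiro signs with bounded partial sums. -/
lemma rudin_shapiro (m : ℕ) : ∃ p : ℕ → ℝ, (∀ j, p j = 1 ∨ p j = -1) ∧
    ∀ v : ℂ, ‖v‖ = 1 → ∀ x ≤ 2 ^ m,
      ‖∑ j ∈ Finset.range x, (p j : ℂ) * v ^ j‖ ≤ 4 * √(2 ^ m) := by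
  obtain ⟨p, q, hp, -, h⟩ := rudin_shapiro_pair m
  exact ⟨p, hp, fun v hv x hx => ((h v hv).2 x hx).1⟩

/-- Bound for geometric sums on the circle by a continuous function. -/
lemma geom_sum_bound (N : ℕ) (hN : 0 < N) (v : ℂ) (hv : ‖v‖ = 1) (x : ℕ) (hx : x ≤ N) :
    ‖∑ j ∈ Finset.range x, v ^ j‖ ≤ 2 / max ‖v - 1‖ (2 / N) := by
  have hN' : (0:ℝ) < N := by exact_mod_cast hN
  rcases le_total ‖v - 1‖ (2 / N) with h | h
  · rw [max_eq_right h]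
    calc ‖∑ j ∈ Finset.range x, v ^ j‖ ≤ ∑ j ∈ Finset.range x, ‖v ^ j‖ := norm_sum_le _ _
      _ = x := by simp [hv]
      _ ≤ N := by exact_mod_cast hx
      _ = _ := by field_simp
  · rw [max_eq_left h]
    have hpos : 0 < ‖v - 1‖ := lt_of_lt_of_le (by positivity) h
    have hv1 : v ≠ 1 := by rintro rfl; simp at hpos
    rw [geom_sum_eq hv1, norm_div]
    gcongr
    calc ‖v ^ x - 1‖ ≤ ‖v ^ x‖ + ‖(1:ℂ)‖ := norm_sub_le _ _
      _ = 2 := by rw [norm_pow, hv]; norm_num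

lemma sqrt_add_le' (a b : ℝ) (ha : 0 ≤ a) (hb : 0 ≤ b) : √(a + b) ≤ √a + √b := by
  rw [Real.sqrt_le_left (by positivity)]
  nlinarith [Real.sq_sqrt ha, Real.sq_sqrt hb, Real.sqrt_nonneg a, Real.sqrt_nonneg b,
    mul_nonneg (Real.sqrt_nonneg a) (Real.sqrt_nonneg b)]

/-- Continuous majorant of geometric sums. -/
noncomputable def zetaFn (N : ℕ) (y : Circ) : ℝ := 2 / max ‖(fourier 1 y : ℂ) - 1‖ (2 / N)

lemma zetaFn_nonneg (N : ℕ) (y : Circ) : 0 ≤ zetaFn N y := by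
  unfold zetaFn; positivity

lemma zetaFn_cont (N : ℕ) (hN : 0 < N) : Continuous (zetaFn N) := by
  unfold zetaFn
  have hN' : (0:ℝ) < N := by exact_mod_cast hN
  have h2 : (0:ℝ) < 2 / N := by positivity
  refine Continuous.div (by fun_prop) (by fun_prop) fun y => ?_
  exact (lt_of_lt_of_le h2 (le_max_right _ _)).ne'

lemma norm_fourier_sub_one_ge (y : ℝ) (hy : |y| ≤ π) :
    (2 / π) * |y| ≤ ‖(fourier 1 (y : Circ) : ℂ) - 1‖ := by
  have e : (fourier 1 (y : Circ) : ℂ) = Complex.exp (Complex.I * y) := by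
    rw [fourier_coe_apply]
    congr 1
    have : (π : ℂ) ≠ 0 := by exact_mod_cast Real.pi_ne_zero
    push_cast
    field_simp
  rw [e, Complex.norm_exp_I_mul_ofReal_sub_one]
  have h : |sin (y / 2)| = sin (|y| / 2) := by
    rcases abs_cases y with ⟨h1, h2⟩ | ⟨h1, h2⟩
    · rw [h1, abs_of_nonneg]
      apply Real.sin_nonneg_of_nonneg_of_le_pi <;> linarith
    · rw [h1, neg_div, Real.sin_neg, abs_of_nonpos]
      apply Real.sin_nonpos_of_nonpos_of_neg_pi_le <;> linarith
  rw [norm_mul, Real.norm_eq_abs, Real.norm_eq_abs, h]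
  have := Real.mul_le_sin (x := |y| / 2) (by positivity) (by linarith)
  have e3 : 2 / π * |y| = 2 * (2 / π * (|y| / 2)) := by ring
  rw [e3]
  simp only [abs_two]
  gcongr

lemma sqrt_zeta_integral : ∃ C : ℝ, ∀ N : ℕ, 0 < N →
    ∫ y : Circ, √(zetaFn N y / 2 + 2) ≤ C := by
  have hii : IntervalIntegrable (fun y : ℝ => √(π / 2) * |y| ^ (-(1/2) : ℝ) + √2) volume (-π) π := by
    have h0 : IntervalIntegrable (fun y : ℝ => |y| ^ (-(1/2) : ℝ)) volume 0 π := by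
      refine (intervalIntegral.intervalIntegrable_rpow' (a := 0) (b := π)
        (r := -(1/2)) (by norm_num)).congr ?_
      rw [Set.uIoc_of_le Real.pi_pos.le]
      intro y hy
      simp only [abs_of_pos hy.1]
    have h1 : IntervalIntegrable (fun y : ℝ => |y| ^ (-(1/2) : ℝ)) volume (-π) 0 := by
      have := (IntervalIntegrable.iff_comp_neg (by finiteness)).mp h0
      simpa using this.symm
    exact ((h1.trans h0).const_mul _).add (by simp)
  refine ⟨∫ y in (-π)..π, (√(π / 2) * |y| ^ (-(1/2) : ℝ) + √2), fun N hN => ?_⟩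
  rw [← AddCircle.intervalIntegral_preimage (2 * π) (-π)]
  rw [show -π + 2 * π = π by ring]
  refine intervalIntegral.integral_mono_ae_restrict (by linarith [Real.pi_pos]) ?_ hii ?_
  swap
  · have h0 : ∀ᵐ y : ℝ ∂(volume.restrict (Set.Icc (-π) π)), y ≠ 0 :=
      ae_restrict_of_ae (Measure.ae_ne volume 0)
    filter_upwards [h0, ae_restrict_mem measurableSet_Icc] with y hy0 hy
    have hy' : |y| ≤ π := abs_le.mpr ⟨hy.1, hy.2⟩
    · have := norm_fourier_sub_one_ge y hy'
      have hyp : 0 < |y| := abs_pos.mpr hy0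
      have hz : zetaFn N (y : Circ) / 2 ≤ (π / 2) * |y| ^ (-1 : ℝ) := by
        unfold zetaFn
        rw [Real.rpow_neg_one, div_div, div_le_iff₀ (by positivity)]
        have h1 : 2 / π * |y| ≤ max ‖(fourier 1 (y : Circ) : ℂ) - 1‖ (2 / N) :=
          this.trans (le_max_left _ _)
        have e1 : 2 = π / 2 * |y|⁻¹ * (2 / π * |y| * 2) := by field_simp
        calc (2:ℝ) = π / 2 * |y|⁻¹ * (2 / π * |y| * 2) := e1
          _ ≤ _ := by gcongr
      calc √(zetaFn N y / 2 + 2) ≤ √(zetaFn N y / 2) + √2 := 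
          sqrt_add_le' _ _ (div_nonneg (zetaFn_nonneg _ _) (by norm_num)) (by norm_num)
        _ ≤ √((π / 2) * |y| ^ (-1 : ℝ)) + √2 := by gcongr
        _ = _ := by
          rw [Real.sqrt_mul (by positivity), Real.sqrt_eq_rpow (|y| ^ (-1:ℝ)),
            ← Real.rpow_mul (abs_nonneg y)]
          norm_num
  · apply Continuous.intervalIntegrable
    have := zetaFn_cont N hN
    fun_prop

/-- A block of signs and offsets such that weighting by offsets is, up to a small error,
the same as averaging over offsets. -/
structure IsBlock (L : ℕ) (κ : ℝ) (J : ℕ) (σ : ℕ → ℝ) (β : ℕ → ℕ) (ξ : C(Circ, ℝ)) : Prop where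
  Jpos : 0 < J
  sgn : ∀ j, σ j = 1 ∨ σ j = -1
  bet : ∀ j, β j < 2 ^ L
  xinn : ∀ y, 0 ≤ ξ y
  xint : ∫ y, ξ y ≤ κ
  hb : ∀ (y : Circ) (x : ℕ), x ≤ J →
    ‖∑ j ∈ Finset.range x, (σ j : ℂ) * (fourier 1 y : ℂ) ^ j‖ ≤ 5 ^ L * √J
  app : ∀ (y : Circ) (x : ℕ), x ≤ J → ∀ e : ℕ → ℂ,
    ‖∑ j ∈ Finset.range x, (σ j : ℂ) * e (β j) * (fourier 1 y : ℂ) ^ j -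
      (∑ b ∈ Finset.range (2 ^ L), e b) / 2 ^ L *
        ∑ j ∈ Finset.range x, (σ j : ℂ) * (fourier 1 y : ℂ) ^ j‖ ≤
    √J * (∑ b ∈ Finset.range (2 ^ L), ‖e b‖) * ξ y ^ 2

lemma sum_range_div_mod {M : Type*} [AddCommMonoid M] (J : ℕ) (hJ : 0 < J) (F : ℕ → ℕ → M)
    (x y : ℕ) (hy : y ≤ J) :
    ∑ j ∈ Finset.range (x * J + y), F (j / J) (j % J) =
      ∑ a ∈ Finset.range x, ∑ b ∈ Finset.range J, F a b + ∑ b ∈ Finset.range y, F x b := by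
  have aux : ∀ x y : ℕ, y ≤ J → ∑ b ∈ Finset.range y, F ((x * J + b) / J) ((x * J + b) % J) =
      ∑ b ∈ Finset.range y, F x b := by
    intro x y hy
    refine Finset.sum_congr rfl fun b hb => ?_
    have hb' : b < J := lt_of_lt_of_le (Finset.mem_range.mp hb) hy
    have h1 : (x * J + b) / J = x := by
      rw [add_comm, Nat.add_mul_div_right _ _ hJ, Nat.div_eq_of_lt hb', zero_add]
    have h2 : (x * J + b) % J = b := by
      rw [add_comm, Nat.add_mul_mod_self_right, Nat.mod_eq_of_lt hb']
    rw [h1, h2]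
  rw [Finset.sum_range_add, aux x y hy]
  congr 1
  induction x with
  | zero => simp
  | succ x ih => rw [Nat.succ_mul, Finset.sum_range_add, ih, aux x J le_rfl, Finset.sum_range_succ]

set_option maxHeartbeats 600000 in
/-- pointwise step -/
lemma block_step_pointwise (L J N : ℕ) (hJ : 0 < J) (σ ε : ℕ → ℝ) (β : ℕ → ℕ)
    (hN : 0 < N)
    (hσ : ∀ j, σ j = 1 ∨ σ j = -1) (hε : ∀ j, ε j = 1 ∨ ε j = -1) (hβ : ∀ j, β j < 2 ^ L)
    (v : ℂ) (hv : ‖v‖ = 1) (X : ℝ) (D : ℝ)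
    (hb : ∀ x : ℕ, x ≤ J → ‖∑ j ∈ Finset.range x, (σ j : ℂ) * v ^ j‖ ≤ 5 ^ L * √J)
    (app : ∀ x : ℕ, x ≤ J → ∀ e : ℕ → ℂ,
      ‖∑ j ∈ Finset.range x, (σ j : ℂ) * e (β j) * v ^ j -
        (∑ b ∈ Finset.range (2 ^ L), e b) / 2 ^ L * ∑ j ∈ Finset.range x, (σ j : ℂ) * v ^ j‖ ≤
      √J * (∑ b ∈ Finset.range (2 ^ L), ‖e b‖) * X)
    (hrs : ∀ x ≤ N, ‖∑ j ∈ Finset.range x, (ε j : ℂ) * (v ^ J) ^ j‖ ≤ 4 * √N)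
    (hD : ∀ x ≤ N, ‖∑ j ∈ Finset.range x, (v ^ J) ^ j‖ ≤ D) :
    (∀ x ≤ N * J, ‖∑ j ∈ Finset.range x, ((ε (j / J) * σ (j % J) : ℝ) : ℂ) * v ^ j‖
      ≤ 5 ^ (L + 1) * √((N * J : ℕ) : ℝ)) ∧
    (∀ x ≤ N * J, ∀ e : ℕ → ℂ,
      ‖∑ j ∈ Finset.range x, ((ε (j / J) * σ (j % J) : ℝ) : ℂ) *
          e ((if ε (j / J) = 1 then 0 else 2 ^ L) + β (j % J)) * v ^ j -
        (∑ b ∈ Finset.range (2 ^ (L + 1)), e b) / 2 ^ (L + 1) *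
          ∑ j ∈ Finset.range x, ((ε (j / J) * σ (j % J) : ℝ) : ℂ) * v ^ j‖ ≤
      √((N * J : ℕ) : ℝ) * (∑ b ∈ Finset.range (2 ^ (L + 1)), ‖e b‖) *
        (2 * X + √(J / N) * (D / 2 + 2))) := by
  have hJ' : (0:ℝ) < J := by exact_mod_cast hJ
  have hN' : (0:ℝ) < N := by exact_mod_cast hN
  have hdecomp : ∀ x ≤ N * J, ∃ x₁ x', x = x₁ * J + x' ∧ x₁ ≤ N ∧ x' ≤ J := by
    intro x hx
    refine ⟨x / J, x % J, (Nat.div_add_mod' x J).symm, ?_, (Nat.mod_lt _ hJ).le⟩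
    exact Nat.div_le_of_le_mul (by rwa [mul_comm])
  have hNJ : √((N * J : ℕ) : ℝ) = √N * √J := by
    push_cast; rw [Real.sqrt_mul hN'.le]
  have hsN : 1 ≤ √(N:ℝ) := by
    rw [Real.one_le_sqrt]; exact_mod_cast hN
  have hvp : ∀ j, v ^ j = (v ^ J) ^ (j / J) * v ^ (j % J) := by
    intro j
    rw [← pow_mul, ← pow_add, Nat.div_add_mod]
  have hεn : ∀ j, ‖(ε j : ℂ)‖ = 1 := by
    intro j; rcases hε j with h | h <;> simp [h]
  have hσn : ∀ j, ‖(σ j : ℂ)‖ = 1 := by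
    intro j; rcases hσ j with h | h <;> simp [h]
  have hVn : ∀ j, ‖(v ^ J) ^ j‖ = 1 := by intro j; simp [hv]
  set H : ℕ → ℂ := fun x => ∑ j ∈ Finset.range x, (σ j : ℂ) * v ^ j with hH
  set h : ℕ → ℂ := fun x => ∑ j ∈ Finset.range x, (ε j : ℂ) * (v ^ J) ^ j with hh
  set G : ℕ → ℂ := fun x => ∑ j ∈ Finset.range x, (v ^ J) ^ j with hG
  have eqH : ∀ x₁ x', x' ≤ J →
      ∑ j ∈ Finset.range (x₁ * J + x'), ((ε (j / J) * σ (j % J) : ℝ) : ℂ) * v ^ j =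
        h x₁ * H J + ε x₁ * (v ^ J) ^ x₁ * H x' := by
    intro x₁ x' hx'
    have := sum_range_div_mod J hJ (fun a b => ((ε a * σ b : ℝ) : ℂ) * ((v ^ J) ^ a * v ^ b))
      x₁ x' hx'
    simp only [← hvp] at this
    rw [this]
    simp only [hH, hh, Finset.mul_sum, Finset.sum_mul]
    rw [Finset.sum_comm]
    congr 1
    · refine Finset.sum_congr rfl fun a _ => Finset.sum_congr rfl fun b _ => ?_
      push_cast; ring
    · refine Finset.sum_congr rfl fun a _ => ?_
      push_cast; ring
  constructor
  · intro x hx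
    obtain ⟨x₁, x', rfl, h1, h2⟩ := hdecomp x hx
    rw [eqH x₁ x' h2, hNJ]
    calc ‖h x₁ * H J + ε x₁ * (v ^ J) ^ x₁ * H x'‖ ≤ ‖h x₁‖ * ‖H J‖ + ‖H x'‖ := by
          refine (norm_add_le _ _).trans ?_
          rw [norm_mul, norm_mul, norm_mul, hεn, hVn, one_mul, one_mul]
      _ ≤ (4 * √N) * (5 ^ L * √J) + 5 ^ L * √J := by
          gcongr
          · exact hrs _ h1
          · exact hb _ le_rfl
          · exact hb _ h2
      _ ≤ 5 ^ (L + 1) * (√N * √J) := by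
          rw [pow_succ]
          have : 0 ≤ 5 ^ L * √(J:ℝ) := by positivity
          nlinarith
  · intro x hx e
    obtain ⟨x₁, x', rfl, h1, h2⟩ := hdecomp x hx
    set e0 : ℕ → ℂ := e with he0
    set e1 : ℕ → ℂ := fun b => e (2 ^ L + b) with he1
    set A := ∑ b ∈ Finset.range (2 ^ (L + 1)), ‖e b‖ with hA
    set E := ∑ b ∈ Finset.range (2 ^ (L + 1)), e b with hE
    have hpow : 2 ^ (L + 1) = 2 ^ L + 2 ^ L := by rw [pow_succ]; ring
    have hE' : E = ∑ b ∈ Finset.range (2 ^ L), (e0 b + e1 b) := by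
      rw [hE, hpow, Finset.sum_range_add, Finset.sum_add_distrib]
    have hA' : A = ∑ b ∈ Finset.range (2 ^ L), (‖e0 b‖ + ‖e1 b‖) := by
      rw [hA, hpow, Finset.sum_range_add, Finset.sum_add_distrib]
    have hA0 : 0 ≤ A := by positivity
    have hEA : ‖E‖ ≤ A := norm_sum_le _ _
    have hpt : ∀ b < 2 ^ L, ‖e0 b‖ + ‖e1 b‖ ≤ A := by
      intro b hb
      rw [hA']
      exact Finset.single_le_sum (f := fun b => ‖e0 b‖ + ‖e1 b‖) (fun i _ => by positivity)
        (Finset.mem_range.mpr hb)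
    set f : ℕ → (ℕ → ℂ) → ℂ := fun x e => ∑ j ∈ Finset.range x, (σ j : ℂ) * e (β j) * v ^ j with hf
    have hbit : ∀ a b, (ε a : ℂ) * e ((if ε a = 1 then 0 else 2 ^ L) + b) =
        1 / 2 * ε a * (e0 b + e1 b) + 1 / 2 * (e0 b - e1 b) := by
      intro a b
      rcases hε a with h | h
      · simp only [h, if_true, zero_add, he0, he1]; push_cast; ring
      · rw [h, if_neg (by norm_num)]; simp only [he0, he1]; push_cast; ring
    have eqf : ∑ j ∈ Finset.range (x₁ * J + x'), ((ε (j / J) * σ (j % J) : ℝ) : ℂ) *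
          e ((if ε (j / J) = 1 then 0 else 2 ^ L) + β (j % J)) * v ^ j =
        1 / 2 * h x₁ * f J (fun b => e0 b + e1 b) + 1 / 2 * G x₁ * f J (fun b => e0 b - e1 b) +
        ε x₁ * (v ^ J) ^ x₁ * f x' (fun b => e ((if ε x₁ = 1 then 0 else 2 ^ L) + b)) := by
      have := sum_range_div_mod J hJ (fun a b => ((ε a * σ b : ℝ) : ℂ) *
          e ((if ε a = 1 then 0 else 2 ^ L) + β b) * ((v ^ J) ^ a * v ^ b))
        x₁ x' h2
      simp only [← hvp] at this
      rw [this]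
      have inner : ∀ a, ∑ b ∈ Finset.range J, ((ε a * σ b : ℝ) : ℂ) *
          e ((if ε a = 1 then 0 else 2 ^ L) + β b) * ((v ^ J) ^ a * v ^ b) =
          1 / 2 * ((ε a : ℂ) * (v ^ J) ^ a) * f J (fun b => e0 b + e1 b) +
          1 / 2 * ((v ^ J) ^ a) * f J (fun b => e0 b - e1 b) := by
        intro a
        simp only [hf, Finset.mul_sum]
        rw [← Finset.sum_add_distrib]
        refine Finset.sum_congr rfl fun b _ => ?_
        have := hbit a (β b)
        calc _ = ((ε a : ℂ) * e ((if ε a = 1 then 0 else 2 ^ L) + β b)) *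
              ((σ b : ℂ) * ((v ^ J) ^ a * v ^ b)) := by push_cast; ring
          _ = _ := by rw [this]; ring
      congr 1
      · rw [Finset.sum_congr rfl fun a _ => inner a, Finset.sum_add_distrib]
        simp only [hh, hG, Finset.mul_sum, Finset.sum_mul]
      · simp only [hf, Finset.mul_sum]
        refine Finset.sum_congr rfl fun a _ => ?_
        push_cast; ring
    have hfJ : ∀ (x : ℕ) (B : ℝ) (e : ℕ → ℂ), x ≤ J → 0 ≤ B → (∀ b < 2 ^ L, ‖e b‖ ≤ B) →
        ‖f x e‖ ≤ J * B := by
      intro x B e hx hB he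
      calc ‖f x e‖ ≤ ∑ j ∈ Finset.range x, B := by
            refine norm_sum_le_of_le _ fun j _ => ?_
            rw [norm_mul, norm_mul, norm_pow, hv, hσn]
            simpa using he _ (hβ j)
        _ = x * B := by simp
        _ ≤ J * B := by gcongr
    have hHJ : ∀ x ≤ J, ‖H x‖ ≤ J := by
      intro x hx
      calc ‖H x‖ ≤ ∑ j ∈ Finset.range x, (1:ℝ) := by
            refine norm_sum_le_of_le _ fun j _ => ?_
            rw [norm_mul, norm_pow, hv, hσn]; simp
        _ = x := by simp
        _ ≤ J := by exact_mod_cast hx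
    rw [eqf, eqH x₁ x' h2]
    have id1 : 1 / 2 * h x₁ * f J (fun b => e0 b + e1 b) + 1 / 2 * G x₁ * f J (fun b => e0 b - e1 b) +
        ε x₁ * (v ^ J) ^ x₁ * f x' (fun b => e ((if ε x₁ = 1 then 0 else 2 ^ L) + b)) -
        E / 2 ^ (L + 1) * (h x₁ * H J + ε x₁ * (v ^ J) ^ x₁ * H x') =
        1 / 2 * h x₁ * (f J (fun b => e0 b + e1 b) - E / 2 ^ L * H J) +
        1 / 2 * G x₁ * f J (fun b => e0 b - e1 b) +
        ε x₁ * (v ^ J) ^ x₁ * (f x' (fun b => e ((if ε x₁ = 1 then 0 else 2 ^ L) + b))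
          - E / 2 ^ (L + 1) * H x') := by
      rw [pow_succ]; field_simp; ring
    rw [id1]
    have b1 : ‖f J (fun b => e0 b + e1 b) - E / 2 ^ L * H J‖ ≤ √J * A * X := by
      have hX := app J le_rfl (fun b => e0 b + e1 b)
      rw [← hE'] at hX
      have hX0 := app J le_rfl (fun _ => 1)
      have hXn : 0 ≤ X := by
        by_contra hc
        push Not at hc
        have : 0 < √(J:ℝ) * (∑ b ∈ Finset.range (2 ^ L), ‖(1:ℂ)‖) := by
          simp; positivity
        nlinarith [norm_nonneg (∑ j ∈ Finset.range J, (σ j : ℂ) * 1 * v ^ j -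
        (∑ b ∈ Finset.range (2 ^ L), 1) / 2 ^ L * ∑ j ∈ Finset.range J, (σ j : ℂ) * v ^ j)]
      have hS : ∑ b ∈ Finset.range (2 ^ L), ‖e0 b + e1 b‖ ≤ A := by
        rw [hA']
        exact Finset.sum_le_sum fun b _ => norm_add_le _ _
      exact le_trans hX (mul_le_mul_of_nonneg_right
        (mul_le_mul_of_nonneg_left hS (Real.sqrt_nonneg _)) hXn)
    have b2 : ‖f J (fun b => e0 b - e1 b)‖ ≤ J * A := by
      refine hfJ J A (fun b => e0 b - e1 b) le_rfl hA0 ?_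
      intro b hb
      exact (norm_sub_le (e0 b) (e1 b)).trans (hpt b hb)
    have b3 : ‖f x' (fun b => e ((if ε x₁ = 1 then 0 else 2 ^ L) + b))‖ ≤ J * A := by
      refine hfJ x' A (fun b => e ((if ε x₁ = 1 then 0 else 2 ^ L) + b)) h2 hA0 ?_
      intro b hb
      have := hpt b hb
      split_ifs
      · rw [zero_add]; exact le_trans (by linarith [norm_nonneg (e1 b)]) this
      · exact le_trans (by linarith [norm_nonneg (e0 b)]) this
    have b4 : ‖E / 2 ^ (L + 1) * H x'‖ ≤ A * J := by
      rw [norm_mul]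
      refine mul_le_mul ?_ (hHJ x' h2) (norm_nonneg _) hA0
      rw [norm_div, norm_pow]
      refine (div_le_self (norm_nonneg _) ?_).trans hEA
      apply one_le_pow₀; simp
    have hD0 : 0 ≤ D := (norm_nonneg _).trans (hD 0 (Nat.zero_le _))
    calc _ ≤ 1 / 2 * (4 * √N) * (√J * A * X) + 1 / 2 * D * (J * A) + (J * A + A * J) := by
          refine (norm_add_le _ _).trans (add_le_add ((norm_add_le _ _).trans (add_le_add ?_ ?_)) ?_)
          · rw [norm_mul, norm_mul]
            have : ‖(1 / 2 : ℂ)‖ = 1 / 2 := by norm_num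
            rw [this]
            have := hrs x₁ h1
            gcongr
          · rw [norm_mul, norm_mul]
            have : ‖(1 / 2 : ℂ)‖ = 1 / 2 := by norm_num
            rw [this]
            have := hD x₁ h1
            gcongr
          · rw [norm_mul, norm_mul, hεn, hVn, one_mul, one_mul]
            exact (norm_sub_le _ _).trans (add_le_add b3 b4)
      _ = √((N * J : ℕ) : ℝ) * A * (2 * X + √(J / N) * (D / 2 + 2)) := by
          rw [hNJ, Real.sqrt_div hJ'.le]
          have h3 : √(J:ℝ) * √(J:ℝ) = J := Real.mul_self_sqrt hJ'.le
          field_simp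
          linear_combination (-(A * (D + 4))) * h3

lemma fourier_pow_nsmul (y : Circ) (J : ℕ) : (fourier 1 y : ℂ) ^ J = fourier 1 (J • y) := by
  simp only [fourier_apply, one_smul, AddCircle.toCircle_nsmul]
  simp

lemma norm_fourier_one (n : ℤ) (y : Circ) : ‖(fourier n y : ℂ)‖ = 1 := by
  rw [fourier_apply]; exact Circle.norm_coe _

lemma integral_comp_nsmul (J : ℕ) (hJ : 0 < J) (F : Circ → ℝ) (hF : Continuous F) :
    ∫ y : Circ, F (J • y) = ∫ y, F y := by
  have h := MeasureTheory.Measure.measurePreserving_zsmul (volume : Measure Circ) (n := (J : ℤ)) (by exact_mod_cast hJ.ne')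
  have := integral_map (μ := (volume : Measure Circ)) (φ := fun y : Circ => (J : ℤ) • y)
    h.measurable.aemeasurable (f := F) hF.aestronglyMeasurable
  rw [h.map_eq] at this
  rw [this]
  simp

lemma block_exists (L : ℕ) : ∀ κ : ℝ, 0 < κ → ∃ J σ β ξ, IsBlock L κ J σ β ξ := by
  induction L with
  | zero =>
    intro κ hκ
    refine ⟨1, fun _ => 1, fun _ => 0, 0, by norm_num, by simp, by simp, by simp, by simp [hκ.le],
      ?_, ?_⟩
    · intro y x hx
      have : x = 0 ∨ x = 1 := by omega
      rcases this with rfl | rfl <;> simp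
    · intro y x hx e
      have : x = 0 ∨ x = 1 := by omega
      rcases this with rfl | rfl <;> simp
  | succ L ih =>
    intro κ hκ
    obtain ⟨J, σ, β, ξ, B⟩ := ih (κ / 4) (by positivity)
    obtain ⟨C, hC⟩ := sqrt_zeta_integral
    have hlim : Tendsto (fun m : ℕ => √√((J:ℝ) / ((2 ^ m : ℕ) : ℝ)) * C) atTop (𝓝 0) := by
      have h1 : Tendsto (fun m : ℕ => ((J:ℝ) / ((2 ^ m : ℕ) : ℝ))) atTop (𝓝 0) := by
        apply Tendsto.const_div_atTop
        exact tendsto_natCast_atTop_atTop.comp (tendsto_pow_atTop_atTop_of_one_lt (by norm_num))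
      have h2 := ((Real.continuous_sqrt.comp Real.continuous_sqrt).tendsto 0).comp h1
      simpa using h2.mul_const C
    obtain ⟨m, hm⟩ := (hlim.eventually (gt_mem_nhds (show (0:ℝ) < κ / 2 by positivity))).exists
    set N := 2 ^ m with hNdef
    have hN : 0 < N := by positivity
    obtain ⟨ε, hε, hrs⟩ := rudin_shapiro m
    have hJ := B.Jpos
    have hζ := zetaFn_cont N hN
    let ξ' : C(Circ, ℝ) := ⟨fun y => √2 * ξ y + √√((J:ℝ) / (N : ℝ)) * √(zetaFn N (J • y) / 2 + 2),
      by fun_prop⟩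
    have hpt := fun y : Circ => block_step_pointwise L J N hJ σ ε β hN B.sgn hε B.bet (fourier 1 y)
      (norm_fourier_one _ _) (ξ y ^ 2) (zetaFn N (J • y)) (B.hb y) (B.app y)
      (by
        intro x hx
        rw [fourier_pow_nsmul]
        have := hrs (fourier 1 (J • y)) (norm_fourier_one _ _) x hx
        rw [hNdef]
        push_cast
        exact this)
      (by
        intro x hx
        rw [fourier_pow_nsmul]
        exact geom_sum_bound N hN _ (norm_fourier_one _ _) x hx)
    refine ⟨N * J, fun j => ε (j / J) * σ (j % J),
      fun j => (if ε (j / J) = 1 then 0 else 2 ^ L) + β (j % J), ξ', Nat.mul_pos hN hJ, ?_, ?_, ?_,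
      ?_, ?_, ?_⟩
    · intro j
      rcases hε (j / J) with h | h <;> rcases B.sgn (j % J) with h' | h' <;> simp [h, h']
    · intro j
      have := B.bet (j % J)
      rw [pow_succ]
      split_ifs <;> omega
    · intro y
      have := B.xinn y
      change 0 ≤ √2 * ξ y + _
      positivity
    · change ∫ y, (√2 * ξ y + √√((J:ℝ) / (N : ℝ)) * √(zetaFn N (J • y) / 2 + 2)) ≤ κ
      have i1 : Integrable (fun y => √2 * ξ y) (volume : Measure Circ) :=
        (by fun_prop : Continuous (fun y => √2 * ξ y)).integrable_of_hasCompactSupport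
          (HasCompactSupport.of_compactSpace _)
      have i2 : Integrable (fun y => √√((J:ℝ) / (N : ℝ)) * √(zetaFn N (J • y) / 2 + 2))
          (volume : Measure Circ) :=
        (by fun_prop : Continuous (fun y : Circ => √√((J:ℝ) / (N : ℝ)) *
          √(zetaFn N (J • y) / 2 + 2))).integrable_of_hasCompactSupport
          (HasCompactSupport.of_compactSpace _)
      rw [integral_add i1 i2, integral_const_mul, integral_const_mul,
        integral_comp_nsmul J hJ (fun y => √(zetaFn N y / 2 + 2)) (by fun_prop)]
      have h1 := B.xint
      have h2 := hC N hN
      have h3 : √2 ≤ 2 := by rw [Real.sqrt_le_left] <;> norm_num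
      have h4 : 0 ≤ ∫ y, ξ y := integral_nonneg B.xinn
      have h5 : √2 * ∫ y, ξ y ≤ 2 * (κ / 4) := by gcongr
      have h6 : √√((J:ℝ) / (N : ℝ)) * ∫ y : Circ, √(zetaFn N y / 2 + 2) ≤
        √√((J:ℝ) / (N : ℝ)) * C := by gcongr
      linarith
    · intro y x hx
      exact (hpt y).1 x hx
    · intro y x hx e
      refine ((hpt y).2 x hx e).trans ?_
      refine mul_le_mul_of_nonneg_left ?_ (by positivity)
      change _ ≤ (√2 * ξ y + √√((J:ℝ) / (N : ℝ)) * √(zetaFn N (J • y) / 2 + 2)) ^ 2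
      have z0 := zetaFn_nonneg N (J • y)
      have z1 : √(zetaFn N (J • y) / 2 + 2) ^ 2 = zetaFn N (J • y) / 2 + 2 :=
        Real.sq_sqrt (by positivity)
      have z2 : √√((J:ℝ) / (N : ℝ)) ^ 2 = √((J:ℝ) / (N : ℝ)) := Real.sq_sqrt (by positivity)
      have z3 : √(2:ℝ) ^ 2 = 2 := Real.sq_sqrt (by positivity)
      have := B.xinn y
      have z4 : 0 ≤ 2 * (√2 * ξ y) * (√√((J:ℝ) / (N : ℝ)) * √(zetaFn N (J • y) / 2 + 2)) := by
        positivity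
      calc 2 * ξ y ^ 2 + √(J / N) * (zetaFn N (J • y) / 2 + 2) =
          √2 ^ 2 * ξ y ^ 2 + √√((J:ℝ) / (N : ℝ)) ^ 2 * √(zetaFn N (J • y) / 2 + 2) ^ 2 := by
            rw [z1, z2, z3]
        _ ≤ _ := by linarith

/-- Riemann-Lebesgue property of a measure on the circle. -/
def RLm (μ : Measure Circ) : Prop :=
  ∀ G : Circ → ℂ, Tendsto (fun n : ℤ => ∫ t, G t * fourier n t ∂μ) cofinite (𝓝 0)

lemma rlm_volume : RLm volume := by
  intro G
  let f : ℝ → ℂ := Set.indicator (Set.Ioc 0 (0 + 2 * π)) (fun x => G (x : Circ))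
  have h := Real.tendsto_integral_exp_smul_cocompact f
  have h2 : Tendsto (fun n : ℤ => -((n : ℝ) / (2 * π))) cofinite (cocompact ℝ) := by
    have h3 : Tendsto (fun n : ℤ => (n : ℝ)) cofinite (cocompact ℝ) := Int.tendsto_coe_cofinite
    have h4 : Tendsto (fun x : ℝ => -(x / (2 * π))) (cocompact ℝ) (cocompact ℝ) := by
      have := (Homeomorph.mulRight₀ (-(2 * π)⁻¹) (by
        rw [neg_ne_zero]; positivity)).isClosedEmbedding.tendsto_cocompact
      refine this.congr fun x => ?_
      simp [div_eq_mul_inv]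
    exact h4.comp h3
  refine (h.comp h2).congr fun n => ?_
  rw [← AddCircle.integral_preimage (2 * π) 0, ← integral_indicator measurableSet_Ioc]
  refine integral_congr_ae (Eventually.of_forall fun x => ?_)
  simp only [f]
  by_cases hx : x ∈ Set.Ioc 0 (0 + 2 * π)
  · rw [Set.indicator_of_mem hx, Set.indicator_of_mem hx, fourier_coe_apply, Circle.smul_def,
      Real.fourierChar_apply, smul_eq_mul, mul_comm]
    congr 2
    have : (π : ℂ) ≠ 0 := by exact_mod_cast Real.pi_ne_zero
    push_cast
    field_simp
  · rw [Set.indicator_of_notMem hx, Set.indicator_of_notMem hx, smul_zero]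

lemma rlm_withDensity (g : Circ → NNReal) (hg : Measurable g) :
    RLm (volume.withDensity fun t => (g t : ENNReal)) := by
  intro G
  refine (rlm_volume (fun t => (g t : ℂ) * G t)).congr fun n => ?_
  rw [integral_withDensity_eq_integral_smul hg]
  refine integral_congr_ae (Eventually.of_forall fun x => ?_)
  simp only [NNReal.smul_def, Complex.real_smul]
  ring

lemma phase_tendsto (p q : ℤ) (h : ¬ (p = 0 ∧ q = 0)) :
    Tendsto (fun r : ℕ => p * (r : ℤ) ^ 2 + 2 * q * r) atTop cofinite := by
  have key : Tendsto (fun r : ℕ => |p * (r : ℤ) ^ 2 + 2 * q * r|) atTop atTop := by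
    rw [tendsto_atTop]
    intro b
    filter_upwards [eventually_ge_atTop (2 * q.natAbs + 1 + b.natAbs)] with r hr
    have hr' : 2 * |q| + 1 + |b| ≤ (r : ℤ) := by
      have := Int.ofNat_le.mpr hr
      push_cast at this
      simpa using this
    have hb : b ≤ |b| := le_abs_self b
    have hr0 : (0:ℤ) ≤ r := by positivity
    have e : p * (r : ℤ) ^ 2 + 2 * q * r = r * (p * r + 2 * q) := by ring
    rw [e, abs_mul, abs_of_nonneg hr0]
    have h1 : 1 ≤ |p * r + 2 * q| := by
      apply Int.one_le_abs
      intro h0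
      rcases eq_or_ne p 0 with hp | hp
      · subst hp; exact h ⟨rfl, by omega⟩
      · have h3 : |p * r| = |2 * q| := by
          rw [show p * r = -(2 * q) by linarith, abs_neg]
        rw [abs_mul, abs_mul, abs_of_nonneg hr0] at h3
        have := Int.one_le_abs hp
        norm_num at h3
        nlinarith [abs_nonneg b]
    nlinarith [abs_nonneg q]
  rw [Int.cofinite_eq, ← Filter.comap_abs_atTop, tendsto_comap_iff]
  exact key

lemma lim_phase (μ : Measure Circ) [IsFiniteMeasure μ] (hμ : RLm μ) (G : Circ → ℂ)
    (hG : Integrable G μ) {ι : Type*} [Fintype ι] (c : ι → ℂ) (p q : ι → ℤ) (r : ℕ → ℕ)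
    (hr : Tendsto r atTop atTop) :
    Tendsto (fun n => ∫ t, G t * ∑ i, c i * fourier (p i * (r n : ℤ) ^ 2 + 2 * q i * r n) t ∂μ)
      atTop (𝓝 ((∑ i, if p i = 0 ∧ q i = 0 then c i else 0) * ∫ t, G t ∂μ)) := by
  have hintg : ∀ n : ℤ, Integrable (fun t => G t * (fourier n t : ℂ)) μ := by
    intro n
    refine hG.mul_bdd (c := 1) (by fun_prop) (Eventually.of_forall fun t => ?_)
    exact (norm_fourier_one n t).le
  have e : ∀ n, ∫ t, G t * ∑ i, c i * fourier (p i * (r n : ℤ) ^ 2 + 2 * q i * r n) t ∂μ =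
      ∑ i, c i * ∫ t, G t * fourier (p i * (r n : ℤ) ^ 2 + 2 * q i * r n) t ∂μ := by
    intro n
    simp only [Finset.mul_sum]
    rw [integral_finsetSum]
    · refine Finset.sum_congr rfl fun i _ => ?_
      rw [← integral_const_mul]
      refine integral_congr_ae (Eventually.of_forall fun x => ?_)
      ring
    · intro i _
      refine ((hintg (p i * (r n : ℤ) ^ 2 + 2 * q i * r n)).const_mul (c i)).congr
        (Eventually.of_forall fun x => ?_)
      ring
  simp only [e]
  rw [Finset.sum_mul]
  refine tendsto_finsetSum _ fun i _ => ?_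
  by_cases h : p i = 0 ∧ q i = 0
  · simp [h.1, h.2]
  · rw [if_neg h, zero_mul]
    have := (hμ G).comp ((phase_tendsto (p i) (q i) h).comp hr)
    simpa using this.const_mul (c i)

lemma fourier_add3 (a b c : ℤ) (t : Circ) :
    (fourier (a + (b + c)) t : ℂ) = fourier a t * (fourier b t * fourier c t) := by
  rw [fourier_add, fourier_add (m := b)]

/-- The increments. -/
noncomputable def incr (α : ℝ) (σ : ℕ → ℝ) (r : ℕ) (x : ℕ) (t : Circ) : ℝ :=
  α * (2 * ((fourier ((r : ℤ) ^ 2) t : ℂ) *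
    ∑ j ∈ Finset.range x, (σ j : ℂ) * (fourier 1 ((2 * r) • t) : ℂ) ^ j).re)

lemma incr_cont (α : ℝ) (σ : ℕ → ℝ) (r : ℕ) (x : ℕ) : Continuous (incr α σ r x) := by
  unfold incr
  fun_prop

lemma fourier_one_nsmul_pow (r j : ℕ) (t : Circ) :
    (fourier 1 ((2 * r) • t) : ℂ) ^ j = fourier (2 * r * j : ℤ) t := by
  rw [fourier_pow_nsmul]
  simp only [fourier_apply, one_smul]
  rw [show (2 * (r:ℤ) * j) = ((j * (2 * r) : ℕ) : ℤ) by push_cast; ring, natCast_zsmul, smul_smul]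

/-- sign of a boolean -/
def bsgn (b : Bool) : ℤ := if b then 1 else -1

lemma incr_eq (α : ℝ) (σ : ℕ → ℝ) (r : ℕ) (x : ℕ) (t : Circ) :
    ((incr α σ r x t : ℝ) : ℂ) = ∑ i : Bool × Fin x, ((α * σ i.2 : ℝ) : ℂ) *
      fourier (bsgn i.1 * (r : ℤ) ^ 2 + 2 * (bsgn i.1 * (i.2 : ℕ)) * r) t := by
  have hre : ∀ z : ℂ, ((2 * z.re : ℝ) : ℂ) = z + (starRingEnd ℂ) z := by
    intro z; rw [Complex.add_conj]
  unfold incr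
  push_cast
  rw [← Complex.ofReal_ofNat, ← Complex.ofReal_mul, hre, Fintype.sum_prod_type]
  simp only [Fintype.sum_bool, bsgn, if_true, Bool.false_eq_true, if_false]
  rw [mul_add]
  simp only [fourier_one_nsmul_pow, Finset.sum_range, map_mul, map_sum, Finset.mul_sum]
  congr 1
  · refine Finset.sum_congr rfl fun j _ => ?_
    rw [show (1 * (r:ℤ) ^ 2 + 2 * (1 * ((j : ℕ) : ℤ)) * r) = (r : ℤ) ^ 2 + 2 * r * (j : ℕ) by ring,
      fourier_add]
    ring
  · refine Finset.sum_congr rfl fun j _ => ?_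
    rw [show (-1 * (r:ℤ) ^ 2 + 2 * (-1 * ((j : ℕ) : ℤ)) * r) =
      -((r : ℤ) ^ 2) + -(2 * r * (j : ℕ)) by ring,
      fourier_add, fourier_neg, fourier_neg]
    simp only [Complex.conj_ofReal]
    ring

lemma incr_bound (α : ℝ) (hα : 0 ≤ α) (σ : ℕ → ℝ) (r x : ℕ) (t : Circ) (C : ℝ)
    (h : ‖∑ j ∈ Finset.range x, (σ j : ℂ) * (fourier 1 ((2 * r) • t) : ℂ) ^ j‖ ≤ C) :
    |incr α σ r x t| ≤ 2 * α * C := by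
  unfold incr
  rw [abs_mul, abs_mul, abs_of_nonneg hα, abs_two]
  have : |((fourier ((r : ℤ) ^ 2) t : ℂ) *
    ∑ j ∈ Finset.range x, (σ j : ℂ) * (fourier 1 ((2 * r) • t) : ℂ) ^ j).re| ≤ C := by
    refine (Complex.abs_re_le_norm _).trans ?_
    rw [norm_mul, norm_fourier_one, one_mul]
    exact h
  nlinarith

lemma bsgn_cases (b : Bool) : bsgn b = 1 ∨ bsgn b = -1 := by cases b <;> simp [bsgn]

lemma tendsto_of_complex {u : ℕ → ℝ} {l : ℝ}
    (h : Tendsto (fun n => ((u n : ℝ) : ℂ)) atTop (𝓝 (l : ℂ))) : Tendsto u atTop (𝓝 l) := by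
  have := (Complex.continuous_re.tendsto (l : ℂ)).comp h
  simpa [Function.comp_def] using this

lemma incr_lim1 (μ : Measure Circ) [IsFiniteMeasure μ] (hμ : RLm μ) (G : Circ → ℝ)
    (hG : Integrable G μ) (α : ℝ) (σ : ℕ → ℝ) (J : ℕ) (r : ℕ → ℕ) (hr : Tendsto r atTop atTop) :
    Tendsto (fun n => ∫ t, G t * incr α σ (r n) J t ∂μ) atTop (𝓝 0) := by
  apply tendsto_of_complex
  have h := lim_phase μ hμ (fun t => (G t : ℂ)) hG.ofReal
    (fun i : Bool × Fin J => ((α * σ i.2 : ℝ) : ℂ)) (fun i => bsgn i.1)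
    (fun i => bsgn i.1 * (i.2 : ℕ)) r hr
  have e : (∑ i : Bool × Fin J, if bsgn i.1 = 0 ∧ bsgn i.1 * ((i.2 : ℕ) : ℤ) = 0 then
    ((α * σ i.2 : ℝ) : ℂ) else 0) = 0 := by
    refine Finset.sum_eq_zero fun i _ => ?_
    rw [if_neg]
    rintro ⟨h, -⟩
    rcases bsgn_cases i.1 with h' | h' <;> omega
  rw [e, zero_mul] at h
  refine h.congr' ?_ |>.trans (by simp)
  refine Eventually.of_forall fun n => ?_
  simp only [← incr_eq, ← Complex.ofReal_mul]
  exact integral_ofReal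

lemma incr_lim2 (μ : Measure Circ) [IsFiniteMeasure μ] (hμ : RLm μ) (G : Circ → ℝ)
    (hG : Integrable G μ) (α : ℝ) (σ : ℕ → ℝ) (J : ℕ) (r : ℕ → ℕ) (hr : Tendsto r atTop atTop)
    (hσ : ∀ j, σ j = 1 ∨ σ j = -1) :
    Tendsto (fun n => ∫ t, G t * incr α σ (r n) J t ^ 2 ∂μ) atTop
      (𝓝 (2 * α ^ 2 * J * ∫ t, G t ∂μ)) := by
  apply tendsto_of_complex
  have h := lim_phase μ hμ (fun t => (G t : ℂ)) hG.ofReal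
    (fun i : (Bool × Fin J) × (Bool × Fin J) =>
      ((α * σ i.1.2 : ℝ) : ℂ) * ((α * σ i.2.2 : ℝ) : ℂ)) (fun i => bsgn i.1.1 + bsgn i.2.1)
    (fun i => bsgn i.1.1 * (i.1.2 : ℕ) + bsgn i.2.1 * (i.2.2 : ℕ)) r hr
  have e : (∑ i : (Bool × Fin J) × (Bool × Fin J),
      if bsgn i.1.1 + bsgn i.2.1 = 0 ∧
        bsgn i.1.1 * ((i.1.2 : ℕ) : ℤ) + bsgn i.2.1 * ((i.2.2 : ℕ) : ℤ) = 0 then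
    ((α * σ i.1.2 : ℝ) : ℂ) * ((α * σ i.2.2 : ℝ) : ℂ) else 0) = ((2 * α ^ 2 * J : ℝ) : ℂ) := by
    rw [Fintype.sum_prod_type]
    have : ∀ a : Bool × Fin J, (∑ b : Bool × Fin J,
      if bsgn a.1 + bsgn b.1 = 0 ∧
        bsgn a.1 * ((a.2 : ℕ) : ℤ) + bsgn b.1 * ((b.2 : ℕ) : ℤ) = 0 then
      ((α * σ a.2 : ℝ) : ℂ) * ((α * σ b.2 : ℝ) : ℂ) else 0) = ((α ^ 2 : ℝ) : ℂ) := by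
      intro a
      rw [Finset.sum_eq_single (!a.1, a.2)]
      · rw [if_pos]
        · rw [← Complex.ofReal_mul]
          congr 1
          rcases hσ a.2 with h | h <;> rw [h] <;> ring
        · rcases a with ⟨a1, a2⟩
          cases a1 <;> simp [bsgn]
      · rintro ⟨b1, b2⟩ - hb
        rw [if_neg]
        rintro ⟨h1, h2⟩
        apply hb
        rcases a with ⟨a1, a2⟩
        dsimp only at h1 h2
        have h3 : b1 = !a1 := by
          cases a1 <;> cases b1 <;> simp [bsgn] at h1 ⊢
        subst h3
        have : (b2 : ℕ) = a2 := by
          cases a1 <;> simp [bsgn] at h2 <;> omega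
        rw [Fin.ext this]
      · simp
    simp only [this]
    simp
    ring
  rw [e] at h
  have e2 : (((2 * α ^ 2 * J : ℝ) : ℂ) * ∫ t, (G t : ℂ) ∂μ) =
      ((2 * α ^ 2 * J * ∫ t, G t ∂μ : ℝ) : ℂ) := by
    have := integral_ofReal (𝕜 := ℂ) (μ := μ) (f := G)
    rw [Complex.ofReal_mul (2 * α ^ 2 * J)]
    exact congrArg _ this
  rw [e2] at h
  refine h.congr' ?_
  refine Eventually.of_forall fun n => ?_
  have e3 : ∀ t, ∑ i : (Bool × Fin J) × (Bool × Fin J),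
      ((α * σ i.1.2 : ℝ) : ℂ) * ((α * σ i.2.2 : ℝ) : ℂ) *
      (fourier ((bsgn i.1.1 + bsgn i.2.1) * (r n : ℤ) ^ 2 +
        2 * (bsgn i.1.1 * (i.1.2 : ℕ) + bsgn i.2.1 * (i.2.2 : ℕ)) * r n) t : ℂ) =
      ((incr α σ (r n) J t ^ 2 : ℝ) : ℂ) := by
    intro t
    rw [pow_two (incr α σ (r n) J t), Complex.ofReal_mul, incr_eq, Fintype.sum_mul_sum, Fintype.sum_prod_type]
    refine Finset.sum_congr rfl fun a _ => Finset.sum_congr rfl fun b _ => ?_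
    rw [show ((bsgn a.1 + bsgn b.1) * (r n : ℤ) ^ 2 +
        2 * (bsgn a.1 * (a.2 : ℕ) + bsgn b.1 * (b.2 : ℕ)) * r n) =
        (bsgn a.1 * (r n : ℤ) ^ 2 + 2 * (bsgn a.1 * (a.2 : ℕ)) * r n) +
        (bsgn b.1 * (r n : ℤ) ^ 2 + 2 * (bsgn b.1 * (b.2 : ℕ)) * r n) by ring, fourier_add]
    ring
  simp only [e3]
  simp only [← Complex.ofReal_mul]
  exact integral_ofReal

lemma incr_lim3 (μ : Measure Circ) [IsFiniteMeasure μ] (hμ : RLm μ) (G : Circ → ℝ)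
    (hG : Integrable G μ) (α : ℝ) (σ : ℕ → ℝ) (J : ℕ) (r : ℕ → ℕ) (hr : Tendsto r atTop atTop)
    :
    Tendsto (fun n => ∫ t, G t * incr α σ (r n) J t ^ 3 ∂μ) atTop (𝓝 0) := by
  apply tendsto_of_complex
  have h := lim_phase μ hμ (fun t => (G t : ℂ)) hG.ofReal
    (fun i : (Bool × Fin J) × (Bool × Fin J) × (Bool × Fin J) =>
      ((α * σ i.1.2 : ℝ) : ℂ) * (((α * σ i.2.1.2 : ℝ) : ℂ) * ((α * σ i.2.2.2 : ℝ) : ℂ)))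
    (fun i => bsgn i.1.1 + (bsgn i.2.1.1 + bsgn i.2.2.1))
    (fun i => bsgn i.1.1 * (i.1.2 : ℕ) + (bsgn i.2.1.1 * (i.2.1.2 : ℕ) +
      bsgn i.2.2.1 * (i.2.2.2 : ℕ))) r hr
  rw [Finset.sum_eq_zero, zero_mul] at h
  swap
  · intro i _
    rw [if_neg]
    rintro ⟨h, -⟩
    rcases bsgn_cases i.1.1 with h1 | h1 <;> rcases bsgn_cases i.2.1.1 with h2 | h2 <;>
      rcases bsgn_cases i.2.2.1 with h3 | h3 <;> omega
  refine h.congr' ?_ |>.trans (by simp)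
  refine Eventually.of_forall fun n => ?_
  have e3 : ∀ t, ∑ i : (Bool × Fin J) × (Bool × Fin J) × (Bool × Fin J),
      ((α * σ i.1.2 : ℝ) : ℂ) * (((α * σ i.2.1.2 : ℝ) : ℂ) * ((α * σ i.2.2.2 : ℝ) : ℂ)) *
      (fourier ((bsgn i.1.1 + (bsgn i.2.1.1 + bsgn i.2.2.1)) * (r n : ℤ) ^ 2 +
        2 * (bsgn i.1.1 * (i.1.2 : ℕ) + (bsgn i.2.1.1 * (i.2.1.2 : ℕ) +
      bsgn i.2.2.1 * (i.2.2.2 : ℕ))) * r n) t : ℂ) =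
      ((incr α σ (r n) J t ^ 3 : ℝ) : ℂ) := by
    intro t
    rw [show incr α σ (r n) J t ^ 3 = incr α σ (r n) J t * (incr α σ (r n) J t *
      incr α σ (r n) J t) by ring, Complex.ofReal_mul, Complex.ofReal_mul, incr_eq,
      Fintype.sum_mul_sum, ← Fintype.sum_prod_type', Fintype.sum_mul_sum,
      Fintype.sum_prod_type]
    refine Finset.sum_congr rfl fun a _ => Finset.sum_congr rfl fun b _ => ?_
    rw [show ((bsgn a.1 + (bsgn b.1.1 + bsgn b.2.1)) * (r n : ℤ) ^ 2 +
        2 * (bsgn a.1 * (a.2 : ℕ) + (bsgn b.1.1 * (b.1.2 : ℕ) +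
      bsgn b.2.1 * (b.2.2 : ℕ))) * r n) =
        (bsgn a.1 * (r n : ℤ) ^ 2 + 2 * (bsgn a.1 * (a.2 : ℕ)) * r n) +
        ((bsgn b.1.1 * (r n : ℤ) ^ 2 + 2 * (bsgn b.1.1 * (b.1.2 : ℕ)) * r n) +
        (bsgn b.2.1 * (r n : ℤ) ^ 2 + 2 * (bsgn b.2.1 * (b.2.2 : ℕ)) * r n)) by ring,
        fourier_add3]
    ring
  simp only [e3]
  simp only [← Complex.ofReal_mul]
  exact integral_ofReal

lemma integral_fourier_zero (n : ℤ) (hn : n ≠ 0) :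
    ∫ t : Circ, (fourier n t : ℂ) ∂AddCircle.haarAddCircle = 0 :=
  integral_eq_zero_of_add_right_eq_neg
    (fourier_add_half_inv_index hn (by positivity : (0:ℝ) < 2 * π))

lemma cont_integrable (μ : Measure Circ) [IsFiniteMeasure μ] {E : Type*} [NormedAddCommGroup E]
    (f : Circ → E) (hf : Continuous f) : Integrable f μ :=
  hf.integrable_of_hasCompactSupport (HasCompactSupport.of_compactSpace _)

lemma equidist_span (μ : Measure Circ) [IsFiniteMeasure μ] (hμ : RLm μ)
    (r : ℕ → ℕ) (hr : Tendsto r atTop atTop) (P : C(Circ, ℂ))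
    (hP : P ∈ Submodule.span ℂ (Set.range (@fourier (2 * π)))) :
    Tendsto (fun n => ∫ t, P ((2 * r n) • t) ∂μ) atTop
      (𝓝 ((μ.real Set.univ : ℂ) * ∫ t, P t ∂AddCircle.haarAddCircle)) := by
  induction hP using Submodule.span_induction with
  | mem P hP =>
    obtain ⟨k, rfl⟩ := hP
    have e : ∀ n (t : Circ), (fourier k ((2 * r n) • t) : ℂ) =
        fourier (0 * (r n : ℤ) ^ 2 + 2 * k * r n) t := by
      intro n t
      simp only [fourier_apply]
      rw [show (0 * (r n : ℤ) ^ 2 + 2 * k * r n) = k * ((2 * r n : ℕ) : ℤ) by push_cast; ring,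
        ← smul_smul k, natCast_zsmul]
    simp only [e]
    rcases eq_or_ne k 0 with rfl | hk
    · simp
    · rw [integral_fourier_zero k hk, mul_zero]
      have := (hμ (fun _ => 1)).comp ((phase_tendsto 0 k (by simp [hk])).comp hr)
      simpa [Function.comp_def] using this
  | zero => simp
  | add P Q _ _ hP hQ =>
    have := hP.add hQ
    rw [← mul_add, ← integral_add (cont_integrable _ _ P.continuous)
      (cont_integrable _ _ Q.continuous)] at this
    refine this.congr fun n => ?_
    rw [← integral_add (cont_integrable _ _ (by fun_prop)) (cont_integrable _ _ (by fun_prop))]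
    rfl
  | smul c P _ hP =>
    have := hP.const_mul c
    rw [mul_left_comm, ← integral_const_mul] at this
    refine this.congr fun n => ?_
    rw [← integral_const_mul]
    rfl

lemma equidist (μ : Measure Circ) [IsFiniteMeasure μ] (hμ : RLm μ) (ξ : C(Circ, ℝ))
    (hξ : ∀ y, 0 ≤ ξ y)
    (r : ℕ → ℕ) (hr : Tendsto r atTop atTop) (δ : ℝ) (hδ : 0 < δ) (κ : ℝ) (hκ : ∫ y, ξ y ≤ κ) :
    ∀ᶠ n in atTop, ∫ t, ξ ((2 * r n) • t) ∂μ ≤ κ * μ.real Set.univ + δ := by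
  set M := μ.real Set.univ with hM
  have hM0 : 0 ≤ M := measureReal_nonneg
  let ξc : C(Circ, ℂ) := ⟨fun t => (ξ t : ℂ), by fun_prop⟩
  have hmem : ξc ∈ (Submodule.span ℂ (Set.range (@fourier (2 * π)))).topologicalClosure := by
    rw [span_fourier_closure_eq_top]; trivial
  obtain ⟨η, hη, hη2⟩ : ∃ η : ℝ, 0 < η ∧ 2 * η * M + η ≤ δ := by
    refine ⟨δ / (2 * M + 1), by positivity, le_of_eq ?_⟩
    field_simp
  obtain ⟨P, hP, hd⟩ := Metric.mem_closure_iff.mp hmem η hη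
  have hpt : ∀ t, ‖ξc t - P t‖ ≤ η := fun t => by
    rw [← dist_eq_norm]; exact (ContinuousMap.dist_apply_le_dist t).trans hd.le
  have h1 := equidist_span μ hμ r hr P hP
  filter_upwards [Metric.tendsto_nhds.mp h1 η hη] with n hn
  rw [dist_eq_norm] at hn
  have a1 : ‖∫ t, ξc ((2 * r n) • t) ∂μ - ∫ t, P ((2 * r n) • t) ∂μ‖ ≤ η * M := by
    rw [← integral_sub (cont_integrable _ _ (by fun_prop)) (cont_integrable _ _ (by fun_prop))]
    exact norm_integral_le_of_norm_le_const (Eventually.of_forall fun t => hpt _)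
  have a2 : ‖∫ t, ξc t ∂AddCircle.haarAddCircle - ∫ t, P t ∂AddCircle.haarAddCircle‖ ≤ η := by
    rw [← integral_sub (cont_integrable _ _ (by fun_prop)) (cont_integrable _ _ (by fun_prop))]
    refine (norm_integral_le_of_norm_le_const (C := η) (Eventually.of_forall fun t => hpt _)).trans ?_
    simp
  have a3 : ∫ t, ξ t ∂AddCircle.haarAddCircle ≤ κ := by
    rw [AddCircle.integral_haarAddCircle, smul_eq_mul]
    have : 0 ≤ ∫ y, ξ y := integral_nonneg hξ
    have h2 : (2 * π)⁻¹ ≤ 1 := by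
      apply inv_le_one_of_one_le₀
      linarith [Real.pi_gt_three]
    nlinarith
  have e1 : ∫ t, ξc ((2 * r n) • t) ∂μ = ((∫ t, ξ ((2 * r n) • t) ∂μ : ℝ) : ℂ) := integral_ofReal
  have e2 : ∫ t, ξc t ∂AddCircle.haarAddCircle =
    ((∫ t, ξ t ∂AddCircle.haarAddCircle : ℝ) : ℂ) := integral_ofReal
  rw [e1] at a1
  rw [e2] at a2
  set I1 := ∫ t, ξ ((2 * r n) • t) ∂μ
  set I2 := ∫ t, P ((2 * r n) • t) ∂μ
  set I3 := ∫ t, ξ t ∂AddCircle.haarAddCircle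
  set I4 := ∫ t, P t ∂AddCircle.haarAddCircle
  have b1 := (Complex.re_le_norm _).trans a1
  have b2 := (Complex.abs_re_le_norm _).trans a2
  have b3 := (Complex.re_le_norm _).trans hn.le
  simp only [Complex.sub_re, Complex.ofReal_re, Complex.re_ofReal_mul] at b1 b2 b3
  have b4 : M * I4.re ≤ M * (I3 + η) := by
    gcongr
    linarith [(abs_le.mp b2).1]
  nlinarith

/-- The inductive package for approximate martingales. -/
structure Mart (μ : Measure Circ) (ω : Circ → ℝ) (X : ℕ → Circ → ℝ) (p : ℕ → Prop) (τ B : ℝ)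
    (Q : ℕ) (δ : ℝ) (ι : ℕ → ℕ) (M S : Circ → ℝ) : Prop where
  good : ∀ k < Q, p (ι k)
  mono : ∀ j k, j < k → k < Q → ι j < ι k
  m1 : |∫ t, ω t * (∑ k ∈ Finset.range Q, X (ι k) t) ∂μ| ≤ δ
  m2 : |∫ t, ω t * (∑ k ∈ Finset.range Q, X (ι k) t) ^ 2 ∂μ - Q * τ * ∫ t, ω t ∂μ| ≤ δ
  m4 : ∫ t, ω t * (∑ k ∈ Finset.range Q, X (ι k) t) ^ 4 ∂μ ≤
    (3 * Q ^ 2 * τ ^ 2 + Q * B ^ 2 * τ) * ∫ t, ω t ∂μ + δ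
  Mm : Measurable M
  Sm : Measurable S
  bd : ∃ C, ∀ t, |M t| ≤ C ∧ |S t| ≤ C
  mx : ∀ t, ∀ q ≤ Q, |∑ k ∈ Finset.range q, X (ι k) t| ≤ M t
  doob : ∀ t, M t ^ 2 / 2 ≤ M t * |∑ k ∈ Finset.range Q, X (ι k) t| - S t
  mS : |∫ t, ω t * S t ∂μ| ≤ δ

lemma mart_exists (μ : Measure Circ) [IsFiniteMeasure μ] (ω : Circ → ℝ) (hω : Integrable ω μ)
    (hω0 : ∀ t, 0 ≤ ω t) (X : ℕ → Circ → ℝ) (hX : ∀ n, Measurable (X n)) (p : ℕ → Prop)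
    (hp : ∀ᶠ n in atTop, p n) (τ B : ℝ) (hτ : 0 ≤ τ) (hB : ∀ n t, |X n t| ≤ B)
    (l1 : ∀ G : Circ → ℝ, Integrable G μ → Tendsto (fun n => ∫ t, G t * X n t ∂μ) atTop (𝓝 0))
    (l2 : ∀ G : Circ → ℝ, Integrable G μ → Tendsto (fun n => ∫ t, G t * X n t ^ 2 ∂μ) atTop
      (𝓝 (τ * ∫ t, G t ∂μ)))
    (l3 : ∀ G : Circ → ℝ, Integrable G μ → Tendsto (fun n => ∫ t, G t * X n t ^ 3 ∂μ) atTop (𝓝 0))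
    (Q : ℕ) : ∀ δ : ℝ, 0 < δ → ∃ ι M S, Mart μ ω X p τ B Q δ ι M S := by
  have hintg : ∀ (F : Circ → ℝ) (C : ℝ), Measurable F → (∀ t, |F t| ≤ C) →
      Integrable (fun t => ω t * F t) μ := by
    intro F C hF hC
    exact hω.mul_bdd hF.aestronglyMeasurable (Eventually.of_forall hC)
  induction Q with
  | zero =>
    intro δ hδ
    refine ⟨fun _ => 0, fun _ => 0, fun _ => 0, by simp, by simp, by simp [hδ.le], by simp [hδ.le],
      by simp [hδ.le], by fun_prop, by fun_prop, ⟨0, by simp⟩, ?_, by simp, by simp [hδ.le]⟩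
    intro t q hq
    have : q = 0 := by omega
    simp [this]
  | succ Q ih =>
    intro δ hδ
    set W := ∫ t, ω t ∂μ with hW
    have hW0 : 0 ≤ W := integral_nonneg hω0
    obtain ⟨δ', hδ', hδ2⟩ : ∃ δ' : ℝ, 0 < δ' ∧ δ' * (6 + 6 * τ + B ^ 2 + 15) ≤ δ := by
      refine ⟨δ / (6 + 6 * τ + B ^ 2 + 15), by positivity, le_of_eq ?_⟩
      field_simp
    obtain ⟨ι, M, S, H⟩ := ih δ' hδ'
    set T : Circ → ℝ := fun t => ∑ k ∈ Finset.range Q, X (ι k) t with hT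
    have hTm : Measurable T := by fun_prop
    obtain ⟨C, hC⟩ := H.bd
    have hTC : ∀ t, |T t| ≤ C := fun t =>
      (H.mx t Q le_rfl).trans ((le_abs_self _).trans (hC t).1)
    let sg : Circ → ℝ := fun t => if 0 ≤ T t then 1 else -1
    have hsg : Measurable sg := Measurable.ite (measurableSet_le measurable_const hTm)
      measurable_const measurable_const
    have hsg1 : ∀ t, |sg t| = 1 := by intro t; simp only [sg]; split_ifs <;> simp
    have hsgT : ∀ t, sg t * T t = |T t| := by
      intro t; simp only [sg]; split_ifs with h
      · rw [abs_of_nonneg h, one_mul]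
      · push Not at h; rw [abs_of_neg h]; ring
    have hC0 : ∀ t : Circ, 0 ≤ C := fun t => (abs_nonneg _).trans (hTC t)
    have iT : Integrable (fun t => ω t * T t) μ := hintg T C hTm hTC
    have iT2 : Integrable (fun t => ω t * T t ^ 2) μ := hintg _ (C ^ 2) (by fun_prop) (by
      intro t; rw [abs_pow]; exact pow_le_pow_left₀ (abs_nonneg _) (hTC t) 2)
    have iT3 : Integrable (fun t => ω t * T t ^ 3) μ := hintg _ (C ^ 3) (by fun_prop) (by
      intro t; rw [abs_pow]; exact pow_le_pow_left₀ (abs_nonneg _) (hTC t) 3)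
    have iT4 : Integrable (fun t => ω t * T t ^ 4) μ := hintg _ (C ^ 4) (by fun_prop) (by
      intro t; rw [abs_pow]; exact pow_le_pow_left₀ (abs_nonneg _) (hTC t) 4)
    have hMm := H.Mm
    have iMs : Integrable (fun t => ω t * (M t * sg t)) μ := hintg _ C (by fun_prop) (by
      intro t; rw [abs_mul, hsg1, mul_one]; exact (hC t).1)
    have iS : Integrable (fun t => ω t * S t) μ := hintg _ C H.Sm (fun t => (hC t).2)
    -- smallness
    have sm : ∀ (u : ℕ → ℝ) (l : ℝ), Tendsto u atTop (𝓝 l) → ∀ᶠ n in atTop, |u n - l| ≤ δ' := by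
      intro u l h
      filter_upwards [Metric.tendsto_nhds.mp h δ' hδ'] with n hn
      exact hn.le
    obtain ⟨n, ⟨⟨⟨⟨⟨⟨⟨⟨⟨hpn, hn⟩, a1⟩, a2⟩, a3⟩, a4⟩, a5⟩, a6⟩, a7⟩, -⟩⟩ :=
      (((((((((hp.and (eventually_gt_atTop (∑ k ∈ Finset.range Q, ι k))).and
        (sm _ _ (l1 _ hω))).and (sm _ _ (l1 _ iT))).and (sm _ _ (l2 _ hω))).and
        (sm _ _ (l1 _ iT3))).and (sm _ _ (l2 _ iT2))).and (sm _ _ (l3 _ iT))).and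
        (sm _ _ (l1 _ iMs))).and (eventually_gt_atTop 0)).exists
    rw [sub_zero] at a1 a2 a4 a6 a7
    set Y := X n with hY
    have hYm : Measurable Y := hX n
    have hYB : ∀ t, |Y t| ≤ B := hB n
    have hιk : ∀ k < Q, Function.update ι Q n k = ι k := by
      intro k hk; rw [Function.update_of_ne hk.ne]
    have hsumq : ∀ q ≤ Q, ∀ t, ∑ k ∈ Finset.range q, X (Function.update ι Q n k) t =
        ∑ k ∈ Finset.range q, X (ι k) t := by
      intro q hq t
      refine Finset.sum_congr rfl fun k hk => ?_
      rw [hιk k (lt_of_lt_of_le (Finset.mem_range.mp hk) hq)]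
    have hsum : ∀ t, ∑ k ∈ Finset.range (Q + 1), X (Function.update ι Q n k) t = T t + Y t := by
      intro t
      rw [Finset.sum_range_succ, hsumq Q le_rfl, Function.update_self]
    have ibY : ∀ (F : Circ → ℝ) (k : ℕ), Integrable F μ → Integrable (fun t => F t * Y t ^ k) μ := by
      intro F k hF
      refine hF.mul_bdd (c := B ^ k) (hYm.pow_const k).aestronglyMeasurable
        (Eventually.of_forall fun t => ?_)
      rw [norm_pow]
      exact pow_le_pow_left₀ (abs_nonneg _) (hYB t) k
    have ibY1 : ∀ (F : Circ → ℝ), Integrable F μ → Integrable (fun t => F t * Y t) μ := by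
      intro F hF; simpa using ibY F 1 hF
    refine ⟨Function.update ι Q n, fun t => max (M t) |T t + Y t|,
      fun t => S t + M t * sg t * Y t, ?_, ?_, ?_, ?_, ?_, ?_, ?_, ?_, ?_, ?_, ?_⟩
    · intro k hk
      rcases Nat.lt_succ_iff_lt_or_eq.mp hk with h | rfl
      · rw [hιk k h]; exact H.good k h
      · rw [Function.update_self]; exact hpn
    · intro j k hjk hk
      rcases Nat.lt_succ_iff_lt_or_eq.mp hk with h | rfl
      · rw [hιk k h, hιk j (hjk.trans h)]; exact H.mono j k hjk h
      · rw [hιk j hjk, Function.update_self]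
        exact lt_of_le_of_lt (Finset.single_le_sum (f := ι) (fun _ _ => Nat.zero_le _)
          (Finset.mem_range.mpr hjk)) hn
    · simp only [hsum, mul_add]
      rw [integral_add iT (ibY1 ω hω)]
      have := H.m1
      refine (abs_add_le _ _).trans ?_
      nlinarith [sq_nonneg B]
    · simp only [hsum]
      have e : ∀ t, ω t * (T t + Y t) ^ 2 =
        ω t * T t ^ 2 + 2 * (ω t * T t * Y t) + ω t * Y t ^ 2 := by intro t; ring
      simp only [e]
      have i12 : Integrable (fun t => ω t * T t ^ 2 + 2 * (ω t * T t * Y t)) μ :=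
        iT2.add ((ibY1 _ iT).const_mul 2)
      rw [integral_add i12 (ibY ω 2 hω),
        integral_add iT2 ((ibY1 _ iT).const_mul 2), integral_const_mul]
      have := H.m2
      have h2 := abs_le.mp a2
      have h3 := abs_le.mp a3
      have h4 := abs_le.mp this
      push_cast
      rw [abs_le]
      constructor <;> nlinarith [sq_nonneg B]
    · simp only [hsum]
      have e : ∀ t, ω t * (T t + Y t) ^ 4 =
        ω t * T t ^ 4 + 4 * (ω t * T t ^ 3 * Y t) + 6 * (ω t * T t ^ 2 * Y t ^ 2) +
          4 * (ω t * T t * Y t ^ 3) + ω t * Y t ^ 4 := by intro t; ring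
      simp only [e]
      have i1 := (ibY1 _ iT3).const_mul 4
      have i2 := (ibY _ 2 iT2).const_mul 6
      have i3 := (ibY _ 3 iT).const_mul 4
      have j1 : Integrable (fun t => ω t * T t ^ 4 + 4 * (ω t * T t ^ 3 * Y t)) μ := iT4.add i1
      have j2 : Integrable (fun t => ω t * T t ^ 4 + 4 * (ω t * T t ^ 3 * Y t) +
        6 * (ω t * T t ^ 2 * Y t ^ 2)) μ := j1.add i2
      have j3 : Integrable (fun t => ω t * T t ^ 4 + 4 * (ω t * T t ^ 3 * Y t) +
        6 * (ω t * T t ^ 2 * Y t ^ 2) + 4 * (ω t * T t * Y t ^ 3)) μ := j2.add i3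
      rw [integral_add j3 (ibY ω 4 hω),
        integral_add j2 i3, integral_add j1 i2,
        integral_add iT4 i1, integral_const_mul, integral_const_mul, integral_const_mul]
      have h5 : ∫ t, ω t * Y t ^ 4 ∂μ ≤ B ^ 2 * ∫ t, ω t * Y t ^ 2 ∂μ := by
        rw [← integral_const_mul]
        refine integral_mono (ibY ω 4 hω) ((ibY ω 2 hω).const_mul _) fun t => ?_
        dsimp only
        have : Y t ^ 2 ≤ B ^ 2 := by rw [← sq_abs]; exact pow_le_pow_left₀ (abs_nonneg _) (hYB t) 2
        nlinarith [mul_nonneg (hω0 t) (sq_nonneg (Y t))]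
      have h3 := (abs_le.mp a3).2
      have h4 := (abs_le.mp a4).2
      have h6 := (abs_le.mp a5).2
      have h7 := (abs_le.mp a6).2
      have h8 := H.m4
      have h9 := (abs_le.mp H.m2).2
      have h10 : B ^ 2 * ∫ t, ω t * Y t ^ 2 ∂μ ≤ B ^ 2 * (τ * W + δ') := by
        gcongr; linarith
      have h11 : τ * ∫ t, ω t * T t ^ 2 ∂μ ≤ τ * (Q * τ * W + δ') := by
        gcongr; linarith
      have h12 : 0 ≤ τ ^ 2 * W := by positivity
      push_cast
      nlinarith
    · exact H.Mm.max (by fun_prop)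
    · have := H.Sm
      fun_prop
    · refine ⟨C + C + B + C * B, fun t => ?_⟩
      have hB0 : 0 ≤ B := (abs_nonneg _).trans (hYB t)
      have hCt := hC0 t
      constructor
      · have h1 : |T t + Y t| ≤ C + B := (abs_add_le _ _).trans (add_le_add (hTC t) (hYB t))
        rw [abs_of_nonneg (le_trans (abs_nonneg (T t + Y t)) (le_max_right _ _))]
        have := (le_abs_self _).trans (hC t).1
        apply max_le <;> nlinarith
      · have h1 : |M t * sg t * Y t| ≤ C * B := by
          rw [abs_mul, abs_mul, hsg1, mul_one]
          exact mul_le_mul (hC t).1 (hYB t) (abs_nonneg _) hCt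
        have := (abs_add_le (S t) (M t * sg t * Y t)).trans (add_le_add (hC t).2 h1)
        linarith
    · intro t q hq
      rcases Nat.le_succ_iff.mp hq with h | rfl
      · rw [hsumq q h]
        exact (H.mx t q h).trans (le_max_left _ _)
      · rw [hsum]
        exact le_max_right _ _
    · intro t
      rw [hsum]
      have h1 := H.doob t
      change M t ^ 2 / 2 ≤ M t * |T t| - S t at h1
      have hM0 : 0 ≤ M t := (abs_nonneg _).trans (H.mx t 0 (Nat.zero_le _))
      have h2 : sg t * (T t + Y t) ≤ |T t + Y t| := by
        refine (le_abs_self _).trans ?_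
        rw [abs_mul, hsg1, one_mul]
      have h3 : M t * (sg t * (T t + Y t)) ≤ M t * |T t + Y t| := by gcongr
      have h4 := hsgT t
      have h5 : S t + M t * sg t * Y t ≤ M t * |T t + Y t| - M t ^ 2 / 2 := by
        rw [← h4] at h1
        nlinarith
      rcases le_total (M t) |T t + Y t| with h | h
      · rw [max_eq_right h]; nlinarith [sq_nonneg (M t - |T t + Y t|)]
      · rw [max_eq_left h]; linarith
    · simp only [mul_add]
      have e : ∀ t, ω t * (M t * sg t * Y t) = ω t * (M t * sg t) * Y t := by intro t; ring
      simp only [e]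
      rw [integral_add iS (ibY1 _ iMs)]
      have := H.mS
      refine (abs_add_le _ _).trans ?_
      nlinarith [sq_nonneg B]

lemma sqrt_abs_one_sub_le (x : ℝ) : √|1 - x| ≤ 1 - x / 2 - x ^ 2 / 16 + x ^ 4 := by
  have h0 : 0 ≤ 1 - x / 2 - x ^ 2 / 16 + x ^ 4 := by
    nlinarith [sq_nonneg (x ^ 2 - 1 / 4), sq_nonneg (x - 4 / 7), sq_nonneg x]
  rw [Real.sqrt_le_left h0, abs_le]
  have key : 1 - x ≤ (1 - x / 2 - x ^ 2 / 16 + x ^ 4) ^ 2 := by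
    have hb : 0 ≤ x ^ 6 - x ^ 4 / 8 - x ^ 3 + (2 + 1 / 256) * x ^ 2 + x / 16 + 1 / 8 := by
      nlinarith [sq_nonneg (x ^ 3 - x / 2), sq_nonneg (x ^ 2 - x / 2), sq_nonneg x,
        sq_nonneg (x + 1 / 8), sq_nonneg (x ^ 2 - x)]
    nlinarith [mul_nonneg (sq_nonneg x) hb]
  constructor
  · rcases le_total x 1 with h | h
    · nlinarith
    · have h2 : x ^ 2 ≤ x ^ 4 := pow_le_pow_right₀ h (by norm_num)
      have h3 : x ≤ 1 - x / 2 - x ^ 2 / 16 + x ^ 4 := by nlinarith [sq_nonneg (x - 4 / 5)]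
      nlinarith
  · exact key

lemma mart_cons (μ : Measure Circ) [IsFiniteMeasure μ] (ω : Circ → ℝ) (hω : Integrable ω μ)
    (hω0 : ∀ t, 0 ≤ ω t) (X : ℕ → Circ → ℝ) (hX : ∀ n, Measurable (X n)) (p : ℕ → Prop)
    (τ B : ℝ) (Q : ℕ) (δ : ℝ) (ι : ℕ → ℕ) (M S : Circ → ℝ)
    (H : Mart μ ω X p τ B Q δ ι M S) (hs : Q * τ = 1 / 192) (hB : B ^ 2 ≤ 1 / 64) :
    Integrable (fun t => ω t * √|1 - ∑ k ∈ Finset.range Q, X (ι k) t|) μ ∧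
    Integrable (fun t => ω t * (2 + M t ^ 2)) μ ∧
    ∫ t, ω t * √|1 - ∑ k ∈ Finset.range Q, X (ι k) t| ∂μ ≤
      (1 - 1 / 6144) * ∫ t, ω t ∂μ + 2 * δ ∧
    ∫ t, ω t * (2 + M t ^ 2) ∂μ ≤ 3 * ∫ t, ω t ∂μ + 8 * δ := by
  have hintg : ∀ (F : Circ → ℝ) (C : ℝ), Measurable F → (∀ t, |F t| ≤ C) →
      Integrable (fun t => ω t * F t) μ := by
    intro F C hF hC
    exact hω.mul_bdd hF.aestronglyMeasurable (Eventually.of_forall hC)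
  set W := ∫ t, ω t ∂μ with hW
  have hW0 : 0 ≤ W := integral_nonneg hω0
  have h1 := H.m1
  have h2 := H.m2
  have h4 := H.m4
  have hM := H.Mm
  have hS := H.Sm
  have mx := H.mx
  have doob := H.doob
  have mS := H.mS
  set T : Circ → ℝ := fun t => ∑ k ∈ Finset.range Q, X (ι k) t with hT
  have hTm : Measurable T := by fun_prop
  obtain ⟨C, hC⟩ := H.bd
  have hTC : ∀ t, |T t| ≤ C := fun t =>
    (mx t Q le_rfl).trans ((le_abs_self _).trans (hC t).1)
  have iT : Integrable (fun t => ω t * T t) μ := hintg T C hTm hTC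
  have iT2 : Integrable (fun t => ω t * T t ^ 2) μ := hintg _ (C ^ 2) (by fun_prop) (by
    intro t; rw [abs_pow]; exact pow_le_pow_left₀ (abs_nonneg _) (hTC t) 2)
  have iT4 : Integrable (fun t => ω t * T t ^ 4) μ := hintg _ (C ^ 4) (by fun_prop) (by
    intro t; rw [abs_pow]; exact pow_le_pow_left₀ (abs_nonneg _) (hTC t) 4)
  have iM : Integrable (fun t => ω t * (2 + M t ^ 2)) μ := hintg _ (2 + C ^ 2) (by fun_prop) (by
    intro t
    rw [abs_of_nonneg (by positivity), ← sq_abs]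
    have := pow_le_pow_left₀ (abs_nonneg _) (hC t).1 2
    linarith)
  have iS : Integrable (fun t => ω t * S t) μ := hintg _ C hS (fun t => (hC t).2)
  have iq : Integrable (fun t => ω t * √|1 - T t|) μ := hintg _ (1 + C) (by fun_prop) (by
    intro t
    have := hTC t
    have h0 := abs_nonneg (T t)
    rw [abs_of_nonneg (by positivity)]
    have h3 : |1 - T t| ≤ 1 + C := by
      have := abs_sub 1 (T t)
      rw [abs_one] at this
      linarith
    rw [Real.sqrt_le_left (by linarith)]
    nlinarith)
  refine ⟨iq, iM, ?_, ?_⟩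
  · have j1 : Integrable (fun t => ω t + (-1 / 2) * (ω t * T t)) μ := hω.add (iT.const_mul _)
    have j2 : Integrable (fun t => ω t + (-1 / 2) * (ω t * T t) + (-1 / 16) * (ω t * T t ^ 2)) μ :=
      j1.add (iT2.const_mul _)
    have j3 : Integrable (fun t => ω t + (-1 / 2) * (ω t * T t) + (-1 / 16) * (ω t * T t ^ 2) +
      ω t * T t ^ 4) μ := j2.add iT4
    have := integral_mono iq j3 (fun t => by
      have := mul_le_mul_of_nonneg_left (sqrt_abs_one_sub_le (T t)) (hω0 t)
      dsimp only
      linarith)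
    refine this.trans ?_
    rw [integral_add j2 iT4, integral_add j1 (iT2.const_mul _), integral_add hω (iT.const_mul _),
      integral_const_mul, integral_const_mul]
    have a1 := (abs_le.mp h1).1
    have a2 := (abs_le.mp h2).1
    rw [hs] at a2
    have a4 : ∫ t, ω t * T t ^ 4 ∂μ ≤ (1 / 12288 + 1 / 12288) * W + δ := by
      refine h4.trans ?_
      have e : 3 * (Q:ℝ) ^ 2 * τ ^ 2 + Q * B ^ 2 * τ = 3 * (Q * τ) ^ 2 + B ^ 2 * (Q * τ) := by ring
      rw [e, hs]
      have : 3 * (1 / 192 : ℝ) ^ 2 + B ^ 2 * (1 / 192) ≤ 1 / 12288 + 1 / 12288 := by linarith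
      gcongr
    have hδ : 0 ≤ δ := (abs_nonneg _).trans h1
    nlinarith
  · have j1 : Integrable (fun t => 2 * ω t + 4 * (ω t * T t ^ 2)) μ :=
      (hω.const_mul 2).add (iT2.const_mul _)
    have j2 : Integrable (fun t => 2 * ω t + 4 * (ω t * T t ^ 2) + (-4) * (ω t * S t)) μ :=
      j1.add (iS.const_mul _)
    have := integral_mono iM j2 (fun t => by
      have hd := doob t
      change M t ^ 2 / 2 ≤ M t * |T t| - S t at hd
      have : M t ^ 2 ≤ 4 * T t ^ 2 - 4 * S t := by
        nlinarith [sq_nonneg (M t - 2 * |T t|), sq_abs (T t)]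
      have := mul_le_mul_of_nonneg_left this (hω0 t)
      dsimp only
      linarith)
    refine this.trans ?_
    rw [integral_add j1 (iS.const_mul _), integral_add (hω.const_mul 2) (iT2.const_mul _),
      integral_const_mul, integral_const_mul, integral_const_mul]
    have a1 := (abs_le.mp mS).1
    have a2 := (abs_le.mp h2).2
    rw [hs] at a2
    nlinarith

noncomputable def psum (N : ℕ) (c : ℤ → ℂ) (t : Circ) : ℂ :=
  ∑ k ∈ Finset.Icc (-(N : ℤ)) (N : ℤ), c k * (fourier k t : ℂ)

lemma psum_add (N : ℕ) (c d : ℤ → ℂ) (t : Circ) : psum N (c + d) t = psum N c t + psum N d t := by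
  simp [psum, add_mul, Finset.sum_add_distrib]

lemma psum_sub (N : ℕ) (c d : ℤ → ℂ) (t : Circ) : psum N (c - d) t = psum N c t - psum N d t := by
  simp [psum, sub_mul, Finset.sum_sub_distrib]

lemma psum_sum {ι : Type*} (N : ℕ) (s : Finset ι) (c : ι → ℤ → ℂ) (t : Circ) :
    psum N (∑ i ∈ s, c i) t = ∑ i ∈ s, psum N (c i) t := by
  simp only [psum, Finset.sum_apply, Finset.sum_mul]
  rw [Finset.sum_comm]

lemma psum_single (N : ℕ) (n : ℤ) (a : ℂ) (t : Circ) :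
    psum N (Pi.single n a) t = if |n| ≤ (N : ℤ) then a * (fourier n t : ℂ) else 0 := by
  unfold psum
  simp only [Pi.single_apply, ite_mul, zero_mul]
  rw [Finset.sum_ite_eq']
  simp only [Finset.mem_Icc, abs_le]

lemma psum_stable (F N : ℕ) (h : F ≤ N) (c : ℤ → ℂ) (hc : ∀ n : ℤ, (F : ℤ) < |n| → c n = 0)
    (t : Circ) : psum N c t = psum F c t := by
  unfold psum
  symm
  refine Finset.sum_subset (fun k hk => ?_) (fun k _ hk => ?_)
  · simp only [Finset.mem_Icc] at hk ⊢; omega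
  · rw [hc k, zero_mul]
    by_contra hh
    push Not at hh
    exact hk (by simpa [Finset.mem_Icc, abs_le] using hh)

lemma psum_cont (N : ℕ) (c : ℤ → ℂ) : Continuous (psum N c) := by
  unfold psum; fun_prop

def lam (h : ℤ) (r : ℕ) (β : ℕ → ℕ) (j : ℕ) : ℤ := (r : ℤ) ^ 2 + 2 * r * j + ((β j : ℤ) - h)

noncomputable def Dx (γ : ℝ) (σ : ℕ → ℝ) (β : ℕ → ℕ) (h : ℤ) (c : ℤ → ℂ) (r x : ℕ) (t : Circ) : ℂ :=
  ∑ j ∈ Finset.range x, ((γ : ℂ) * (σ j : ℂ)) * (c (β j - h) * (fourier (lam h r β j) t : ℂ) +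
    c (h - β j) * (fourier (-lam h r β j) t : ℂ))

noncomputable def dco (γ : ℝ) (σ : ℕ → ℝ) (β : ℕ → ℕ) (h : ℤ) (c : ℤ → ℂ) (J r : ℕ) : ℤ → ℂ :=
  ∑ j ∈ Finset.range J, (Pi.single (lam h r β j) (((γ : ℂ) * (σ j : ℂ)) * c (β j - h)) +
    Pi.single (-lam h r β j) (((γ : ℂ) * (σ j : ℂ)) * c (h - β j)))

lemma mono_cut (P : ℕ → Prop) (J : ℕ) (hP : ∀ i j, i ≤ j → j < J → P j → P i) :
    ∃ x ≤ J, ∀ j < J, P j ↔ j < x := by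
  induction J with
  | zero => exact ⟨0, le_rfl, by simp⟩
  | succ J ih =>
    obtain ⟨x, hx, h⟩ := ih fun i j hij hj => hP i j hij (hj.trans (Nat.lt_succ_self _))
    by_cases hJ : P J
    · refine ⟨J + 1, le_rfl, fun j hj => ⟨fun _ => hj, fun _ => hP j J (by omega) (by omega) hJ⟩⟩
    · refine ⟨x, by omega, fun j hj => ?_⟩
      rcases Nat.lt_succ_iff_lt_or_eq.mp hj with h1 | rfl
      · exact h j h1
      · exact ⟨fun h => absurd h hJ, fun h => by omega⟩

lemma lam_bounds (h : ℤ) (r : ℕ) (β : ℕ → ℕ) (j : ℕ) (hr : h < r) (hβ : (β j : ℤ) < 2 * h) :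
    (r : ℤ) ^ 2 + 2 * r * j - r < lam h r β j ∧ lam h r β j < (r : ℤ) ^ 2 + 2 * r * j + r := by
  unfold lam
  constructor <;> linarith [Int.natCast_nonneg (β j)]

lemma lam_mono (h : ℤ) (r : ℕ) (β : ℕ → ℕ) (i j : ℕ) (hij : i < j) (hr : h < r)
    (hβ : ∀ j, (β j : ℤ) < 2 * h) : lam h r β i < lam h r β j := by
  have h1 := (lam_bounds h r β i hr (hβ i)).2
  have h2 := (lam_bounds h r β j hr (hβ j)).1
  have : (i : ℤ) + 1 ≤ j := by exact_mod_cast hij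
  nlinarith [Int.natCast_nonneg r]

lemma lam_pos (h : ℤ) (r : ℕ) (β : ℕ → ℕ) (j : ℕ) (hr : h < r)
    (hβ : ∀ j, (β j : ℤ) < 2 * h) : (r : ℤ) ^ 2 - r < lam h r β j := by
  have h2 := (lam_bounds h r β j hr (hβ j)).1
  nlinarith [Int.natCast_nonneg r, Int.natCast_nonneg j]

lemma lam_pos' (h : ℤ) (r : ℕ) (β : ℕ → ℕ) (j : ℕ) (hr : h < r)
    (hβ : ∀ j, (β j : ℤ) < 2 * h) : 0 < lam h r β j := by
  have h2 := lam_pos h r β j hr hβ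
  nlinarith [Int.natCast_nonneg r, sq_nonneg ((r : ℤ) - 1), Int.natCast_nonneg (β j), hβ j]

lemma psum_dco (γ : ℝ) (σ : ℕ → ℝ) (β : ℕ → ℕ) (h : ℤ) (c : ℤ → ℂ) (J r : ℕ) (hr : h < r)
    (hβ : ∀ j, (β j : ℤ) < 2 * h) (N : ℕ) :
    ∃ x ≤ J, (∀ j < J, lam h r β j ≤ N ↔ j < x) ∧
      ∀ t, psum N (dco γ σ β h c J r) t = Dx γ σ β h c r x t := by
  obtain ⟨x, hx, hcut⟩ := mono_cut (fun j => lam h r β j ≤ N) J (by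
    intro i j hij _ hj
    rcases hij.lt_or_eq with h1 | rfl
    · exact (lam_mono h r β i j h1 hr hβ).le.trans hj
    · exact hj)
  refine ⟨x, hx, hcut, fun t => ?_⟩
  unfold dco Dx
  rw [psum_sum]
  have hsub : Finset.range x ⊆ Finset.range J := Finset.range_subset_range.mpr hx
  symm
  rw [← Finset.sum_sdiff hsub]
  rw [Finset.sum_eq_zero (s := Finset.range J \ Finset.range x), zero_add]
  · refine Finset.sum_congr rfl fun j hj => ?_
    have hj' : j < x := Finset.mem_range.mp hj
    have h1 := (hcut j (by omega)).mpr hj'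
    have h0 := lam_pos' h r β j hr hβ
    rw [psum_add, psum_single, psum_single, abs_neg, abs_of_pos h0, if_pos h1, if_pos h1]
    ring
  · intro j hj
    simp only [Finset.mem_sdiff, Finset.mem_range] at hj
    have h1 := mt (hcut j hj.1).mp hj.2
    have h0 := lam_pos' h r β j hr hβ
    rw [psum_add, psum_single, psum_single, abs_neg, abs_of_pos h0, if_neg h1, if_neg h1, zero_add]

lemma sum_shift (L : ℕ) (c : ℤ → ℂ) (hc : ∀ n : ℤ, (2 : ℤ) ^ L ≤ |n| → c n = 0) (t : Circ) :
    ∑ b ∈ Finset.range (2 ^ (L + 1)), c ((b : ℤ) - 2 ^ L) * (fourier ((b : ℤ) - 2 ^ L) t : ℂ)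
      = psum (2 ^ L) c t := by
  have hc2 : c (2 ^ L) = 0 := hc _ (le_abs_self _)
  have e : ∀ g : ℤ → ℂ, ∑ b ∈ Finset.range (2 ^ (L + 1)), g ((b : ℤ) - 2 ^ L) =
      ∑ k ∈ Finset.Ico (-(2 ^ L : ℤ)) (2 ^ L), g k := by
    intro g
    refine Finset.sum_bij (fun b _ => (b : ℤ) - 2 ^ L) ?_ ?_ ?_ ?_
    · intro b hb
      simp only [Finset.mem_range, Finset.mem_Ico] at hb ⊢
      have : (b : ℤ) < 2 ^ (L + 1) := by exact_mod_cast hb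
      rw [pow_succ] at this
      constructor <;> omega
    · intro a _ b _ hab
      simpa using hab
    · intro k hk
      simp only [Finset.mem_Ico] at hk
      refine ⟨(k + 2 ^ L).toNat, ?_, ?_⟩
      · rw [Finset.mem_range]
        zify
        rw [Int.toNat_of_nonneg (by linarith), pow_succ]
        linarith
      · rw [Int.toNat_of_nonneg (by linarith)]; ring
    · intro _ _; rfl
  rw [e (fun k => c k * (fourier k t : ℂ))]
  unfold psum
  push_cast
  refine Finset.sum_subset (fun k hk => ?_) (fun k hk hk2 => ?_)
  · simp only [Finset.mem_Icc, Finset.mem_Ico] at hk ⊢; constructor <;> linarith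
  · simp only [Finset.mem_Icc, Finset.mem_Ico, not_and, not_lt] at hk hk2
    have : k = 2 ^ L := le_antisymm hk.2 (hk2 hk.1)
    rw [this, hc2, zero_mul]

lemma sum_shift_neg (L : ℕ) (c : ℤ → ℂ) (hc : ∀ n : ℤ, (2 : ℤ) ^ L ≤ |n| → c n = 0) (t : Circ) :
    ∑ b ∈ Finset.range (2 ^ (L + 1)), c (2 ^ L - (b : ℤ)) * (fourier (2 ^ L - (b : ℤ)) t : ℂ)
      = psum (2 ^ L) c t := by
  have h1 := sum_shift L (fun n => c (-n)) (fun n hn => hc _ (by rwa [abs_neg])) (-t)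
  have e : psum (2 ^ L) c t = psum (2 ^ L) (fun n => c (-n)) (-t) := by
    unfold psum
    refine Finset.sum_bij (fun k _ => -k) ?_ ?_ ?_ ?_
    · intro k hk; simp only [Finset.mem_Icc] at hk ⊢; constructor <;> linarith
    · intro a _ b _ hab; simpa using hab
    · intro k hk; simp only [Finset.mem_Icc] at hk ⊢
      exact ⟨-k, ⟨by linarith, by linarith⟩, by simp⟩
    · intro k _; simp [fourier_apply]
  rw [e, ← h1]
  refine Finset.sum_congr rfl fun b _ => ?_
  rw [neg_sub]
  congr 1
  simp only [fourier_apply]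
  congr 2
  rw [smul_neg, ← neg_smul, neg_sub]

lemma Dx_approx (L : ℕ) (κ : ℝ) (J : ℕ) (σ : ℕ → ℝ) (β : ℕ → ℕ) (ξ : C(Circ, ℝ))
    (HB : IsBlock (L + 1) κ J σ β ξ) (c : ℤ → ℂ) (hc : ∀ n : ℤ, (2 : ℤ) ^ L ≤ |n| → c n = 0)
    (a : ℝ) (ha : 0 ≤ a) (r x : ℕ) (hx : x ≤ J) (t : Circ) :
    ‖Dx (a / √J * 2 ^ (L + 1)) σ β (2 ^ L) c r x t
      - psum (2 ^ L) c t * (incr (a / √J) σ r x t : ℂ)‖ ≤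
      a * 2 ^ (L + 1) * (∑ b ∈ Finset.range (2 ^ (L + 1)), ‖c ((b : ℤ) - 2 ^ L)‖ +
        ∑ b ∈ Finset.range (2 ^ (L + 1)), ‖c (2 ^ L - (b : ℤ))‖) * ξ ((2 * r) • t) ^ 2 := by
  set γ : ℝ := a / √J * 2 ^ (L + 1) with hγ
  have hJ : (0 : ℝ) < √J := Real.sqrt_pos.mpr (by exact_mod_cast HB.Jpos)
  have hγ0 : 0 ≤ γ := by positivity
  have hγJ : γ * √J = a * 2 ^ (L + 1) := by rw [hγ]; field_simp
  set Z := psum (2 ^ L) c t with hZ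
  set u : ℂ := fourier ((r : ℤ) ^ 2) t with hu
  set v : ℂ := fourier 1 ((2 * r) • t) with hv
  set e : ℕ → ℂ := fun b => c ((b : ℤ) - 2 ^ L) * (fourier ((b : ℤ) - 2 ^ L) t : ℂ) with he
  set e' : ℕ → ℂ := fun b => c (2 ^ L - (b : ℤ)) * (fourier (2 ^ L - (b : ℤ)) t : ℂ) with he'
  set h : ℂ := ∑ j ∈ Finset.range x, (σ j : ℂ) * v ^ j with hh
  have sumE : ∑ b ∈ Finset.range (2 ^ (L + 1)), e b = Z := sum_shift L c hc t
  have sumE' : ∑ b ∈ Finset.range (2 ^ (L + 1)), e' b = Z := sum_shift_neg L c hc t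
  have nu : ‖u‖ = 1 := norm_fourier_one _ _
  have A1 := HB.app ((2 * r) • t) x hx e
  have A2 := HB.app ((2 * r) • t) x hx (fun b => (starRingEnd ℂ) (e' b))
  rw [sumE] at A1
  rw [← map_sum, sumE'] at A2
  simp only [RCLike.norm_conj] at A2
  have ne : ∀ b, ‖e b‖ = ‖c ((b : ℤ) - 2 ^ L)‖ := by
    intro b; rw [he]; dsimp only; rw [norm_mul, norm_fourier_one, mul_one]
  have ne' : ∀ b, ‖e' b‖ = ‖c (2 ^ L - (b : ℤ))‖ := by
    intro b; rw [he']; dsimp only; rw [norm_mul, norm_fourier_one, mul_one]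
  simp only [ne] at A1
  simp only [ne'] at A2
  rw [← hv, ← hh] at A1 A2
  set s1 := ∑ j ∈ Finset.range x, (σ j : ℂ) * e (β j) * v ^ j with hs1
  set s2 := ∑ j ∈ Finset.range x, (σ j : ℂ) * (starRingEnd ℂ) (e' (β j)) * v ^ j with hs2
  set K1 := ∑ b ∈ Finset.range (2 ^ (L + 1)), ‖c ((b : ℤ) - 2 ^ L)‖
  set K2 := ∑ b ∈ Finset.range (2 ^ (L + 1)), ‖c (2 ^ L - (b : ℤ))‖
  have hvj : ∀ j : ℕ, v ^ j = (fourier (2 * r * j : ℤ) t : ℂ) := fun j => fourier_one_nsmul_pow r j t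
  have eD : Dx γ σ β (2 ^ L) c r x t = γ * (u * s1) + γ * ((starRingEnd ℂ) (u * s2)) := by
    unfold Dx
    rw [hs1, hs2, map_mul, map_sum, Finset.mul_sum, Finset.mul_sum, Finset.mul_sum, Finset.mul_sum,
      ← Finset.sum_add_distrib]
    refine Finset.sum_congr rfl fun j _ => ?_
    have l1 : (fourier (lam (2 ^ L) r β j) t : ℂ) =
        u * v ^ j * (fourier ((β j : ℤ) - 2 ^ L) t : ℂ) := by
      rw [hvj, hu, ← fourier_add, ← fourier_add]; rfl
    have l2 : (fourier (-lam (2 ^ L) r β j) t : ℂ) = (starRingEnd ℂ) u * (starRingEnd ℂ) (v ^ j) *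
        (fourier (2 ^ L - (β j : ℤ)) t : ℂ) := by
      rw [hvj, hu, ← fourier_neg, ← fourier_neg, ← fourier_add, ← fourier_add]
      congr 2
      unfold lam
      ring
    rw [l1, l2]
    simp only [map_mul, Complex.conj_conj, Complex.conj_ofReal, he, he']
    ring
  have eI : Z * (incr (a / √J) σ r x t : ℂ) =
      γ * (u * (Z / 2 ^ (L + 1) * h)) +
        γ * ((starRingEnd ℂ) (u * ((starRingEnd ℂ) Z / 2 ^ (L + 1) * h))) := by
    have ei : (incr (a / √J) σ r x t : ℂ) = ((a / √J : ℝ) : ℂ) * (u * h + (starRingEnd ℂ) (u * h)) := by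
      unfold incr
      rw [Complex.add_conj]
      push_cast
      rfl
    rw [ei, hγ]
    simp only [map_mul, map_div₀, Complex.conj_conj, map_pow, Complex.conj_ofNat]
    push_cast
    field_simp
  rw [eD, eI]
  have hd : γ * (u * s1) + γ * ((starRingEnd ℂ) (u * s2)) -
      (γ * (u * (Z / 2 ^ (L + 1) * h)) +
        γ * ((starRingEnd ℂ) (u * ((starRingEnd ℂ) Z / 2 ^ (L + 1) * h)))) =
      γ * (u * (s1 - Z / 2 ^ (L + 1) * h)) +
      γ * ((starRingEnd ℂ) (u * (s2 - (starRingEnd ℂ) Z / 2 ^ (L + 1) * h))) := by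
    simp only [map_mul, map_sub]; ring
  rw [hd]
  refine (norm_add_le _ _).trans ?_
  simp only [norm_mul, RCLike.norm_conj, nu, one_mul, Complex.norm_real, Real.norm_eq_abs,
    abs_of_nonneg hγ0]
  calc _ ≤ γ * (√J * K1 * ξ ((2 * r) • t) ^ 2) + γ * (√J * K2 * ξ ((2 * r) • t) ^ 2) := by
        gcongr
    _ = γ * √J * (K1 + K2) * ξ ((2 * r) • t) ^ 2 := by ring
    _ = _ := by rw [hγJ]

lemma lam_lt_next (h : ℤ) (r r' J : ℕ) (β : ℕ → ℕ) (j : ℕ) (hj : j < J) (hr : h < r)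
    (hβ : ∀ j, (β j : ℤ) < 2 * h) (hrr : r + J + 1 ≤ r') :
    lam h r β j < (r' : ℤ) ^ 2 - r' := by
  have h1 := (lam_bounds h r β j hr (hβ j)).2
  have h2 : (r : ℤ) + J + 1 ≤ r' := by exact_mod_cast hrr
  have h3 : (j : ℤ) + 1 ≤ J := by exact_mod_cast hj
  have h0 : (0:ℤ) ≤ r := Int.natCast_nonneg r
  have hJ : (0:ℤ) ≤ J := Int.natCast_nonneg J
  nlinarith [mul_nonneg h0 hJ]

lemma psum_multi (γ : ℝ) (σ : ℕ → ℝ) (β : ℕ → ℕ) (h : ℤ) (c : ℤ → ℂ) (J Q : ℕ) (R : ℕ → ℕ)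
    (hR : ∀ q < Q, h < R q) (hβ : ∀ j, (β j : ℤ) < 2 * h)
    (hRR : ∀ p q, p < q → q < Q → R p + J + 1 ≤ R q) (N : ℕ) :
    ∃ x : ℕ → ℕ, ∃ q0 : ℕ, (∀ q, x q ≤ J) ∧ (∀ q < q0, x q = J) ∧ (∀ q, q0 < q → x q = 0) ∧
      (∀ q, Q ≤ q → x q = 0) ∧ q0 ≤ Q ∧
      ∀ t, psum N (∑ q ∈ Finset.range Q, dco γ σ β h c J (R q)) t =
        ∑ q ∈ Finset.range Q, Dx γ σ β h c (R q) (x q) t := by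
  have H : ∀ q, ∃ x, q < Q → x ≤ J ∧ (∀ j < J, lam h (R q) β j ≤ N ↔ j < x) ∧
      ∀ t, psum N (dco γ σ β h c J (R q)) t = Dx γ σ β h c (R q) x t := by
    intro q
    by_cases hq : q < Q
    · obtain ⟨x, h1, h2, h3⟩ := psum_dco γ σ β h c J (R q) (hR q hq) hβ N
      exact ⟨x, fun _ => ⟨h1, h2, h3⟩⟩
    · exact ⟨0, fun h => absurd h hq⟩
  choose x hx using H
  obtain ⟨q1, hq1, hcut⟩ := mono_cut (fun q => (R q : ℤ) ^ 2 - R q ≤ N) Q (by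
    intro i j hij hj hN
    rcases hij.lt_or_eq with h1 | rfl
    · refine le_trans ?_ hN
      have h2 : (R i : ℤ) + J + 1 ≤ R j := by exact_mod_cast hRR i j h1 hj
      have h0 : (0:ℤ) ≤ R i := Int.natCast_nonneg _
      have hJ : (0:ℤ) ≤ J := Int.natCast_nonneg J
      nlinarith [mul_nonneg h0 hJ]
    · exact hN)
  have hzero : ∀ q < Q, q1 ≤ q → x q = 0 := by
    intro q hq hq1
    by_contra h0
    obtain ⟨k1, k2, -⟩ := hx q hq
    have h3 := (k2 0 (by omega)).mpr (by omega)
    have h4 := lam_pos h (R q) β 0 (hR q hq) hβ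
    have := (hcut q hq).mp (by linarith)
    omega
  have hfull : ∀ q, q + 1 < q1 → x q = J := by
    intro q hq
    obtain ⟨k1, k2, -⟩ := hx q (by omega)
    refine le_antisymm k1 (not_lt.mp fun hlt => ?_)
    have h5 := (hcut (q + 1) (by omega)).mpr hq
    have h6 := lam_lt_next h (R q) (R (q + 1)) J β (x q) hlt (hR q (by omega)) hβ
      (hRR q (q + 1) (by omega) (by omega))
    have := (k2 (x q) hlt).mp (by linarith)
    omega
  refine ⟨fun q => if q < Q then x q else 0, q1 - 1, ?_, ?_, ?_, ?_, by omega, ?_⟩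
  · intro q; dsimp only; split_ifs with hq
    · exact (hx q hq).1
    · omega
  · intro q hq
    dsimp only
    rw [if_pos (by omega)]
    exact hfull q (by omega)
  · intro q hq
    dsimp only; split_ifs with hq2
    · exact hzero q hq2 (by omega)
    · rfl
  · intro q hq
    dsimp only
    rw [if_neg (by omega)]
  · intro t
    rw [psum_sum]
    refine Finset.sum_congr rfl fun q hq => ?_
    have hq' := Finset.mem_range.mp hq
    dsimp only
    rw [if_pos hq']
    exact (hx q hq').2.2 t

lemma dco_support (γ : ℝ) (σ : ℕ → ℝ) (β : ℕ → ℕ) (h : ℤ) (c : ℤ → ℂ) (J r : ℕ) (n : ℤ)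
    (hn : dco γ σ β h c J r n ≠ 0) : ∃ j < J, n = lam h r β j ∨ n = - lam h r β j := by
  by_contra hcon
  push Not at hcon
  apply hn
  unfold dco
  rw [Finset.sum_apply]
  refine Finset.sum_eq_zero fun j hj => ?_
  obtain ⟨h1, h2⟩ := hcon j (Finset.mem_range.mp hj)
  simp [h1, h2]

def Rich (Λ : Set ℤ) : Prop := ∀ (L : ℕ) (κ : ℝ), 0 < κ → ∃ J σ β ξ, ∃ r : ℕ → ℕ,
  IsBlock (L + 1) κ J σ β ξ ∧ (∀ n, 2 ^ L < r n) ∧ (∀ n, r n + J + 1 ≤ r (n + 1)) ∧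
  ∀ n, ∀ j < J, lam (2 ^ L) (r n) β j ∈ Λ ∧ -lam (2 ^ L) (r n) β j ∈ Λ

lemma sqrt_add_sum_sq_le (A : ℝ) (hA : 0 ≤ A) (Q : ℕ) (ν : ℕ → ℝ) (hν : ∀ q, 0 ≤ ν q) :
    √(A + ∑ q ∈ Finset.range Q, ν q ^ 2) ≤ √A + ∑ q ∈ Finset.range Q, ν q := by
  have h2 : 0 ≤ ∑ q ∈ Finset.range Q, ν q := Finset.sum_nonneg fun q _ => hν q
  have h1 : ∑ q ∈ Finset.range Q, ν q ^ 2 ≤ (∑ q ∈ Finset.range Q, ν q) ^ 2 :=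
    Finset.sum_sq_le_sq_sum_of_nonneg fun q _ => hν q
  refine (sqrt_add_le' A _ hA (Finset.sum_nonneg fun q _ => sq_nonneg _)).trans ?_
  gcongr
  rw [Real.sqrt_le_left h2]
  exact h1

set_option maxHeartbeats 1000000 in
lemma stage (Λ : Set ℤ) (hΛ : Rich Λ) (μ : Measure Circ) [IsFiniteMeasure μ] (hμ : RLm μ)
    (c : ℤ → ℂ) (K : ℕ) (hcK : ∀ n : ℤ, (K : ℤ) < |n| → c n = 0) (ε : ℝ) (hε : 0 < ε) (F : ℕ) :
    ∃ F' : ℕ, F < F' ∧ ∃ d : ℤ → ℂ,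
      (∀ n, d n ≠ 0 → n ∈ Λ ∧ (F : ℤ) < |n| ∧ |n| ≤ (F' : ℤ)) ∧
      ∫ t, √‖psum K c t - psum F' d t‖ ∂μ ≤ (1 - 1 / 6144) * ∫ t, √‖psum K c t‖ ∂μ + ε ∧
      ∃ η : Circ → ℝ, Integrable η μ ∧ (∀ N t, √‖psum N d t‖ ≤ η t) ∧
        ∫ t, η t ∂μ ≤ 3 * ∫ t, √‖psum K c t‖ ∂μ + ε := by
  obtain ⟨L, hL⟩ : ∃ L : ℕ, K < 2 ^ L := ⟨K, Nat.lt_two_pow_self⟩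
  have hLz : (K : ℤ) < 2 ^ L := by exact_mod_cast hL
  have hc : ∀ n : ℤ, (2 : ℤ) ^ L ≤ |n| → c n = 0 := fun n hn => hcK n (by linarith)
  have hZL : ∀ t, psum K c t = psum (2 ^ L) c t := fun t => (psum_stable K (2 ^ L) hL.le c hcK t).symm
  simp only [hZL]
  set Z : Circ → ℂ := psum (2 ^ L) c with hZ
  have hZc : Continuous Z := psum_cont _ _
  set ω : Circ → ℝ := fun t => √‖Z t‖ with hω
  have hωc : Continuous ω := by fun_prop
  have hωi : Integrable ω μ := cont_integrable μ ω hωc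
  have hω0 : ∀ t, 0 ≤ ω t := fun t => Real.sqrt_nonneg _
  set K0 : ℝ := ∑ b ∈ Finset.range (2 ^ (L + 1)), ‖c ((b : ℤ) - 2 ^ L)‖ +
        ∑ b ∈ Finset.range (2 ^ (L + 1)), ‖c (2 ^ L - (b : ℤ))‖ with hK0
  have hK00 : 0 ≤ K0 := by positivity
  obtain ⟨Q, hQ⟩ : ∃ Q : ℕ, Q = 25 ^ (L + 1) := ⟨_, rfl⟩
  have hQ0 : (0 : ℝ) < Q := by rw [hQ]; positivity
  set a : ℝ := √(1 / (384 * Q)) with ha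
  have ha0 : 0 ≤ a := Real.sqrt_nonneg _
  have ha2 : a ^ 2 = 1 / (384 * Q) := Real.sq_sqrt (by positivity)
  set B : ℝ := 2 * a * 5 ^ (L + 1) with hB
  have hB2 : B ^ 2 = 1 / 96 := by
    have e : B ^ 2 = 4 * a ^ 2 * 25 ^ (L + 1) := by
      rw [hB, mul_pow, mul_pow, ← pow_mul, mul_comm (L + 1) 2, pow_mul]; norm_num
    have hQr : (Q : ℝ) = 25 ^ (L + 1) := by rw [hQ]; push_cast; rfl
    rw [e, ha2, ← hQr]
    field_simp
    norm_num
  have hB0 : 0 ≤ B := by positivity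
  have hB1 : B ≤ 1 := by nlinarith
  set ν0 : ℝ := √(a * 2 ^ (L + 1) * K0) with hν0
  have hν00 : 0 ≤ ν0 := Real.sqrt_nonneg _
  have hν2 : ν0 ^ 2 = a * 2 ^ (L + 1) * K0 := Real.sq_sqrt (by positivity)
  have hm0 : 0 ≤ μ.real Set.univ := measureReal_nonneg
  obtain ⟨κ, hκ0, hκ⟩ : ∃ κ : ℝ, 0 < κ ∧ Q * (ν0 * (κ * μ.real Set.univ + κ)) ≤ ε / 2 := by
    refine ⟨ε / 2 / (Q * (ν0 + 1) * (μ.real Set.univ + 1)), by positivity, ?_⟩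
    have e : Q * ((ν0 + 1) * (ε / 2 / (Q * (ν0 + 1) * (μ.real Set.univ + 1)) * μ.real Set.univ
      + ε / 2 / (Q * (ν0 + 1) * (μ.real Set.univ + 1)))) = ε / 2 := by
      field_simp
    refine le_trans ?_ e.le
    gcongr
    linarith
  obtain ⟨J, σ, β, ξ, r, HB, hrL, hrJ, hrΛ⟩ := hΛ L κ hκ0
  have hJ0 : (0 : ℝ) < J := by exact_mod_cast HB.Jpos
  have hJs : (0 : ℝ) < √J := Real.sqrt_pos.mpr hJ0
  set α : ℝ := a / √J with hα
  have hα0 : 0 ≤ α := by positivity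
  have hαJ : α * √J = a := by rw [hα]; field_simp
  have hrm : StrictMono r := strictMono_nat_of_lt_succ fun n => by have := hrJ n; omega
  have hrt : Tendsto r atTop atTop := hrm.tendsto_atTop
  have hrlt : ∀ m n, m < n → r m + J + 1 ≤ r n := by
    intro m n hmn
    exact (hrJ m).trans (hrm.monotone hmn)
  have hincB : ∀ n x t, x ≤ J → |incr α σ (r n) x t| ≤ B := by
    intro n x t hx
    refine (incr_bound α hα0 σ (r n) x t (5 ^ (L + 1) * √J) (HB.hb _ x hx)).trans (le_of_eq ?_)
    rw [hB, ← hαJ]; ring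
  set X : ℕ → Circ → ℝ := fun n => incr α σ (r n) J with hX
  have hXm : ∀ n, Measurable (X n) := fun n => (incr_cont α σ (r n) J).measurable
  set τ : ℝ := 2 * α ^ 2 * J with hτ
  have hτa : τ = 2 * a ^ 2 := by
    rw [hτ, ← hαJ, mul_pow, Real.sq_sqrt hJ0.le]; ring
  have hQτ : Q * τ = 1 / 192 := by
    rw [hτa, ha2]; field_simp; norm_num
  obtain ⟨ι, M, S, HM⟩ := mart_exists μ ω hωi hω0 X hXm
    (fun n => F < r n ∧ ∫ t, ξ ((2 * r n) • t) ∂μ ≤ κ * μ.real Set.univ + κ)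
    ((hrt.eventually_gt_atTop F).and (equidist μ hμ ξ HB.xinn r hrt κ hκ0 κ HB.xint))
    τ B (by positivity) (fun n t => hincB n J t le_rfl)
    (fun G hG => incr_lim1 μ hμ G hG α σ J r hrt)
    (fun G hG => incr_lim2 μ hμ G hG α σ J r hrt HB.sgn)
    (fun G hG => incr_lim3 μ hμ G hG α σ J r hrt) Q (ε / 16) (by positivity)
  obtain ⟨c1, c2, c3, c4⟩ := mart_cons μ ω hωi hω0 X hXm _ τ B Q (ε / 16) ι M S HM hQτ
    (by rw [hB2]; norm_num)
  set h : ℤ := 2 ^ L with hh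
  have hβ : ∀ j, (β j : ℤ) < 2 * h := by
    intro j
    have := HB.bet j
    have h2 : (β j : ℤ) < 2 ^ (L + 1) := by exact_mod_cast this
    rw [pow_succ] at h2; rw [hh]; linarith
  set R : ℕ → ℕ := fun q => r (ι q) with hR
  have hRh : ∀ q, h < R q := by intro q; rw [hh]; exact_mod_cast hrL (ι q)
  have hRR : ∀ p q, p < q → q < Q → R p + J + 1 ≤ R q := fun p q hpq hq =>
    hrlt _ _ (HM.mono p q hpq hq)
  set γ : ℝ := α * 2 ^ (L + 1) with hγ
  set d : ℤ → ℂ := ∑ q ∈ Finset.range Q, dco γ σ β h c J (R q) with hd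
  have dsup : ∀ n, d n ≠ 0 → ∃ q < Q, ∃ j < J, n = lam h (R q) β j ∨ n = - lam h (R q) β j := by
    intro n hn
    rw [hd, Finset.sum_apply] at hn
    obtain ⟨q, hq, hq2⟩ := Finset.exists_ne_zero_of_sum_ne_zero hn
    exact ⟨q, Finset.mem_range.mp hq, dco_support _ _ _ _ _ _ _ _ hq2⟩
  -- the error functions
  set ν : ℕ → Circ → ℝ := fun q t => ν0 * ξ ((2 * R q) • t) with hν
  have hνn : ∀ q t, 0 ≤ ν q t := fun q t => mul_nonneg hν00 (HB.xinn _)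
  have hνi : ∀ q, Integrable (ν q) μ := fun q => cont_integrable μ _ (by
    rw [hν]; dsimp only; fun_prop)
  have hνint : ∫ t, ∑ q ∈ Finset.range Q, ν q t ∂μ ≤ ε / 2 := by
    rw [integral_finsetSum _ fun q _ => hνi q]
    refine le_trans (Finset.sum_le_card_nsmul _ _ (ν0 * (κ * μ.real Set.univ + κ)) ?_) ?_
    · intro q hq
      rw [hν]
      dsimp only
      rw [integral_const_mul]
      exact mul_le_mul_of_nonneg_left (HM.good q (Finset.mem_range.mp hq)).2 hν00
    · rw [Finset.card_range, nsmul_eq_mul]; exact hκ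
  have hνsum : Integrable (fun t => ∑ q ∈ Finset.range Q, ν q t) μ :=
    integrable_finsetSum _ fun q _ => hνi q
  have approx : ∀ (x : ℕ → ℕ) (t : Circ), (∀ q, x q ≤ J) →
      ‖∑ q ∈ Finset.range Q, Dx γ σ β h c (R q) (x q) t -
        Z t * ((∑ q ∈ Finset.range Q, incr α σ (R q) (x q) t : ℝ) : ℂ)‖ ≤
        ∑ q ∈ Finset.range Q, ν q t ^ 2 := by
    intro x t hx
    rw [Complex.ofReal_sum, Finset.mul_sum, ← Finset.sum_sub_distrib]
    refine (norm_sum_le _ _).trans (Finset.sum_le_sum fun q _ => ?_)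
    refine (Dx_approx L κ J σ β ξ HB c hc a ha0 (R q) (x q) (hx q) t).trans (le_of_eq ?_)
    rw [hν]
    dsimp only
    rw [mul_pow, hν2]
  have key := psum_multi γ σ β h c J Q R (fun q _ => hRh q) hβ hRR
  refine ⟨F + 1 + ∑ q ∈ Finset.range Q, ∑ j ∈ Finset.range J, (lam h (R q) β j).natAbs, by omega,
    d, ?_, ?_, ?_⟩
  · intro n hn
    obtain ⟨q, hq, j, hj, hcase⟩ := dsup n hn
    have hpos := lam_pos' h (R q) β j (hRh q) hβ
    have hab : |n| = lam h (R q) β j := by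
      rcases hcase with rfl | rfl
      · exact abs_of_pos hpos
      · rw [abs_neg]; exact abs_of_pos hpos
    refine ⟨?_, ?_, ?_⟩
    · have := hrΛ (ι q) j hj
      rcases hcase with rfl | rfl
      · exact this.1
      · exact this.2
    · rw [hab]
      have h1 := lam_pos h (R q) β j (hRh q) hβ
      have h2 : (F : ℤ) < R q := by exact_mod_cast (HM.good q hq).1
      have h3 : (2 : ℤ) ≤ R q := by
        have := hRh q
        have h4 : (0:ℤ) < h := by rw [hh]; positivity
        linarith
      nlinarith
    · rw [hab]
      have h1 : (lam h (R q) β j).natAbs ≤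
          ∑ q ∈ Finset.range Q, ∑ j ∈ Finset.range J, (lam h (R q) β j).natAbs := by
        refine le_trans ?_ (Finset.single_le_sum
          (f := fun q => ∑ j ∈ Finset.range J, (lam h (R q) β j).natAbs)
          (fun _ _ => Nat.zero_le _) (Finset.mem_range.mpr hq))
        exact Finset.single_le_sum (f := fun j => (lam h (R q) β j).natAbs)
          (fun _ _ => Nat.zero_le _) (Finset.mem_range.mpr hj)
      omega
  · set F' := F + 1 + ∑ q ∈ Finset.range Q, ∑ j ∈ Finset.range J, (lam h (R q) β j).natAbs with hF'
    have hfull : ∀ t, psum F' d t = ∑ q ∈ Finset.range Q, Dx γ σ β h c (R q) J t := by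
      intro t
      rw [hd, psum_sum]
      refine Finset.sum_congr rfl fun q hq => ?_
      obtain ⟨x, k1, k2, k3⟩ := psum_dco γ σ β h c J (R q) (hRh q) hβ F'
      rw [k3 t]
      have : x = J := by
        refine le_antisymm k1 (not_lt.mp fun hlt => ?_)
        have h1 : (lam h (R q) β x).natAbs ≤
          ∑ q ∈ Finset.range Q, ∑ j ∈ Finset.range J, (lam h (R q) β j).natAbs := by
          refine le_trans ?_ (Finset.single_le_sum
            (f := fun q => ∑ j ∈ Finset.range J, (lam h (R q) β j).natAbs)
            (fun _ _ => Nat.zero_le _) hq)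
          exact Finset.single_le_sum (f := fun j => (lam h (R q) β j).natAbs)
            (fun _ _ => Nat.zero_le _) (Finset.mem_range.mpr hlt)
        have := (k2 x hlt).mp (by omega)
        omega
      rw [this]
    have hpt : ∀ t, √‖Z t - psum F' d t‖ ≤
        ω t * √|1 - ∑ k ∈ Finset.range Q, X (ι k) t| + ∑ q ∈ Finset.range Q, ν q t := by
      intro t
      have h1 := approx (fun _ => J) t (fun _ => le_rfl)
      set T : ℝ := ∑ k ∈ Finset.range Q, X (ι k) t with hT
      change ‖∑ q ∈ Finset.range Q, Dx γ σ β h c (R q) J t - Z t * (T : ℂ)‖ ≤ _ at h1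
      rw [← hfull] at h1
      have h2 : ‖Z t - psum F' d t‖ ≤ ‖Z t‖ * |1 - T| + ∑ q ∈ Finset.range Q, ν q t ^ 2 := by
        have e : Z t - psum F' d t = Z t * ((1 - T : ℝ) : ℂ) - (psum F' d t - Z t * (T : ℂ)) := by
          push_cast; ring
        rw [e]
        refine (norm_sub_le _ _).trans ?_
        rw [norm_mul, Complex.norm_real, Real.norm_eq_abs]
        gcongr
      refine (Real.sqrt_le_sqrt h2).trans ?_
      refine (sqrt_add_sum_sq_le _ (by positivity) Q _ (fun q => hνn q t)).trans ?_
      rw [Real.sqrt_mul (norm_nonneg _)]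
    have hdc : Continuous (psum F' d) := psum_cont _ _
    have := integral_mono (μ := μ) (cont_integrable μ (fun t => √‖Z t - psum F' d t‖)
      (by fun_prop)) (c1.add hνsum) hpt
    refine this.trans ?_
    simp only [Pi.add_apply]
    rw [integral_add c1 hνsum]
    linarith
  · refine ⟨fun t => ω t * (2 + M t ^ 2) + ∑ q ∈ Finset.range Q, ν q t, c2.add hνsum, ?_, ?_⟩
    · intro N t
      obtain ⟨x, q0, x1, x2, x3, x4, hq0, hps⟩ := key N
      have h1 := approx x t x1
      rw [← hps t] at h1
      set T : ℝ := ∑ q ∈ Finset.range Q, incr α σ (R q) (x q) t with hT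
      have hM0 : 0 ≤ M t := (abs_nonneg _).trans (HM.mx t 0 (Nat.zero_le _))
      have hz : ∀ q, incr α σ (R q) 0 t = 0 := by intro q; simp [incr]
      have hTM : |T| ≤ M t + 1 := by
        have e : T = ∑ q ∈ Finset.range q0, X (ι q) t + incr α σ (R q0) (x q0) t := by
          rw [← Finset.sum_congr rfl (fun q hq => by
            rw [x2 q (Finset.mem_range.mp hq)] :
              ∀ q ∈ Finset.range q0, incr α σ (R q) (x q) t = X (ι q) t),
            ← Finset.sum_range_succ (fun q => incr α σ (R q) (x q) t)]
          rcases hq0.lt_or_eq with hlt | heq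
          · rw [hT]
            symm
            refine Finset.sum_subset (Finset.range_subset_range.mpr hlt) fun q _ hq => ?_
            rw [x3 q (by simpa using hq), hz]
          · rw [hT, heq, Finset.sum_range_succ, x4 Q le_rfl, hz, add_zero]
        rw [e]
        refine (abs_add_le _ _).trans (add_le_add (HM.mx t q0 hq0) ?_)
        exact (hincB (ι q0) (x q0) t (x1 q0)).trans hB1
      have h2 : ‖psum N d t‖ ≤ ‖Z t‖ * (M t + 1) + ∑ q ∈ Finset.range Q, ν q t ^ 2 := by
        have e : psum N d t = Z t * (T : ℂ) + (psum N d t - Z t * (T : ℂ)) := by ring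
        rw [e]
        refine (norm_add_le _ _).trans ?_
        rw [norm_mul, Complex.norm_real, Real.norm_eq_abs]
        gcongr
      refine (Real.sqrt_le_sqrt h2).trans ?_
      refine (sqrt_add_sum_sq_le _ (by positivity) Q _ (fun q => hνn q t)).trans ?_
      rw [Real.sqrt_mul (norm_nonneg _)]
      have h3 : √(M t + 1) ≤ 2 + M t ^ 2 := by
        rw [Real.sqrt_le_left (by positivity)]
        nlinarith [sq_nonneg (M t - 1), sq_nonneg (M t ^ 2)]
      have := mul_le_mul_of_nonneg_left h3 (hω0 t)
      exact add_le_add this le_rfl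
    · rw [integral_add c2 hνsum]
      linarith

lemma span_psum (g : C(Circ, ℂ)) (hg : g ∈ Submodule.span ℂ (Set.range (@fourier (2 * π)))) :
    ∃ (K : ℕ) (c : ℤ → ℂ), (∀ n : ℤ, (K : ℤ) < |n| → c n = 0) ∧ ∀ t, g t = psum K c t := by
  induction hg using Submodule.span_induction with
  | mem x hx =>
    obtain ⟨n, rfl⟩ := hx
    refine ⟨n.natAbs, Pi.single n 1, ?_, ?_⟩
    · intro m hm
      rw [Pi.single_apply, if_neg]
      rintro rfl
      rw [Int.natCast_natAbs] at hm
      exact lt_irrefl _ hm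
    · intro t
      rw [psum_single, if_pos (by rw [Int.natCast_natAbs]), one_mul]
  | zero => exact ⟨0, 0, fun _ _ => rfl, fun t => by simp [psum]⟩
  | add x y _ _ hx hy =>
    obtain ⟨K1, c1, h1, e1⟩ := hx
    obtain ⟨K2, c2, h2, e2⟩ := hy
    refine ⟨max K1 K2, c1 + c2, ?_, ?_⟩
    · intro n hn
      push_cast at hn
      have := max_lt_iff.mp hn
      rw [Pi.add_apply, h1 n this.1, h2 n this.2, add_zero]
    · intro t
      rw [psum_add, psum_stable K1 _ (le_max_left _ _) c1 h1, psum_stable K2 _ (le_max_right _ _) c2 h2,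
        ← e1, ← e2]
      rfl
  | smul a x _ hx =>
    obtain ⟨K1, c1, h1, e1⟩ := hx
    refine ⟨K1, fun n => a * c1 n, fun n hn => by simp [h1 n hn], fun t => ?_⟩
    have : (a • x) t = a * x t := rfl
    rw [this, e1]
    simp only [psum, Finset.mul_sum, mul_assoc]

lemma sqrt_le_lin (δ y : ℝ) (hδ : 0 < δ) (hy : 0 ≤ y) : √y ≤ δ + y / δ := by
  rw [Real.sqrt_le_left (by positivity)]
  have h1 : y / δ * δ = y := by field_simp
  have h2 : 0 ≤ y / δ := by positivity
  nlinarith [sq_nonneg δ, sq_nonneg (y / δ)]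

lemma int_sqrt (μ : Measure Circ) [IsFiniteMeasure μ] (f : Circ → ℂ) (hf : Integrable f μ) :
    Integrable (fun t => √‖f t‖) μ := by
  have h1 : Integrable (fun t => 1 + ‖f t‖ / 1) μ := (integrable_const 1).add (hf.norm.div_const 1)
  refine h1.mono' ?_ (Eventually.of_forall fun t => ?_)
  · exact (Real.continuous_sqrt.comp_aestronglyMeasurable hf.1.norm)
  · rw [Real.norm_eq_abs, abs_of_nonneg (Real.sqrt_nonneg _)]
    exact sqrt_le_lin 1 _ one_pos (norm_nonneg _)

lemma trig_approx (μ : Measure Circ) [IsFiniteMeasure μ] (f : Circ → ℂ) (hf : Integrable f μ)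
    (ε : ℝ) (hε : 0 < ε) :
    ∃ (K : ℕ) (c : ℤ → ℂ), (∀ n : ℤ, (K : ℤ) < |n| → c n = 0) ∧
      ∫ t, √‖f t - psum K c t‖ ∂μ ≤ ε := by
  set m := μ.real Set.univ with hm
  have hm0 : 0 ≤ m := measureReal_nonneg
  set δ : ℝ := ε / (2 * (m + 1)) with hδ
  have hδ0 : 0 < δ := by positivity
  have hδm : δ * m ≤ ε / 2 := by
    have : δ * (m + 1) = ε / 2 := by rw [hδ]; field_simp
    nlinarith
  set δ2 : ℝ := δ * ε / 4 with hδ2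
  have hδ20 : 0 < δ2 := by positivity
  obtain ⟨g, -, hg, hgc, hgi⟩ := hf.exists_hasCompactSupport_integral_sub_le hδ20
  let gc : C(Circ, ℂ) := ⟨g, hgc⟩
  have hmem : gc ∈ (Submodule.span ℂ (Set.range (@fourier (2 * π)))).topologicalClosure := by
    rw [span_fourier_closure_eq_top]; trivial
  obtain ⟨p, hp, hd⟩ := Metric.mem_closure_iff.mp hmem (δ2 / (m + 1)) (by positivity)
  obtain ⟨K, c, hc, e⟩ := span_psum p hp
  refine ⟨K, c, hc, ?_⟩
  have hpi : Integrable (psum K c) μ := cont_integrable μ _ (psum_cont K c)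
  have hpt : ∀ t, ‖g t - psum K c t‖ ≤ δ2 / (m + 1) := by
    intro t
    rw [← e t, ← dist_eq_norm]
    exact (ContinuousMap.dist_apply_le_dist (f := gc) (g := p) t).trans hd.le
  have hgp : ∫ t, ‖g t - psum K c t‖ ∂μ ≤ δ2 := by
    refine (integral_mono (hgi.sub hpi).norm (integrable_const _) hpt).trans ?_
    rw [integral_const, smul_eq_mul, ← hm]
    have : (m + 1) * (δ2 / (m + 1)) = δ2 := by field_simp
    have h0 : 0 ≤ δ2 / (m + 1) := by positivity
    nlinarith
  have hfp : ∫ t, ‖f t - psum K c t‖ ∂μ ≤ 2 * δ2 := by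
    refine (integral_mono (hf.sub hpi).norm ((hf.sub hgi).norm.add (hgi.sub hpi).norm)
      (fun t => ?_)).trans ?_
    · have := norm_add_le (f t - g t) (g t - psum K c t)
      rw [sub_add_sub_cancel] at this
      exact this
    · have : ∫ t, ‖f t - g t‖ + ‖g t - psum K c t‖ ∂μ = _ :=
        integral_add (hf.sub hgi).norm (hgi.sub hpi).norm
      refine le_trans (le_of_eq this) ?_
      linarith
  have hfpi : Integrable (fun t => f t - psum K c t) μ := hf.sub hpi
  refine (integral_mono (int_sqrt μ _ hfpi) ((integrable_const δ).add (hfpi.norm.div_const δ))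
    (fun t => sqrt_le_lin δ _ hδ0 (norm_nonneg _))).trans ?_
  have : ∫ t, δ + ‖f t - psum K c t‖ / δ ∂μ = _ :=
    integral_add (integrable_const δ) (hfpi.norm.div_const δ)
  refine le_trans (le_of_eq this) ?_
  rw [integral_const, smul_eq_mul, ← hm, integral_div]
  have h5 : (∫ t, ‖f t - psum K c t‖ ∂μ) / δ ≤ 2 * δ2 / δ := by gcongr
  have h6 : 2 * δ2 / δ = ε / 2 := by rw [hδ2]; field_simp; norm_num
  linarith

lemma sqrt_norm_le (a b : ℂ) : √‖a + b‖ ≤ √‖a‖ + √‖b‖ :=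
  (Real.sqrt_le_sqrt (norm_add_le a b)).trans (sqrt_add_le' _ _ (norm_nonneg _) (norm_nonneg _))

lemma step (Λ : Set ℤ) (hΛ : Rich Λ) (μ : Measure Circ) [IsFiniteMeasure μ] (hμ : RLm μ)
    (f : Circ → ℂ) (hf : Integrable f μ)
    (F : ℕ) (S : ℤ → ℂ) (hS : ∀ n : ℤ, (F : ℤ) < |n| → S n = 0) (ε : ℝ) (hε : 0 < ε) :
    ∃ F' : ℕ, F < F' ∧ ∃ d : ℤ → ℂ,
      (∀ n, d n ≠ 0 → n ∈ Λ ∧ (F : ℤ) < |n| ∧ |n| ≤ (F' : ℤ)) ∧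
      ∫ t, √‖f t - psum F' (S + d) t‖ ∂μ ≤ (1 - 1 / 6144) * ∫ t, √‖f t - psum F S t‖ ∂μ + ε ∧
      ∃ η : Circ → ℝ, Integrable η μ ∧ (∀ N t, √‖psum N d t‖ ≤ η t) ∧
        ∫ t, η t ∂μ ≤ 3 * ∫ t, √‖f t - psum F S t‖ ∂μ + ε := by
  obtain ⟨K, p, hp, hfp⟩ := trig_approx μ f hf (ε / 8) (by positivity)
  have hcs : ∀ n : ℤ, ((max K F : ℕ) : ℤ) < |n| → (p - S) n = 0 := by
    intro n hn
    push_cast at hn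
    have := max_lt_iff.mp hn
    rw [Pi.sub_apply, hp n this.1, hS n this.2, sub_zero]
  obtain ⟨F', hF', d, hd, h1, η, hη, h2, h3⟩ := stage Λ hΛ μ hμ (p - S) (max K F) hcs (ε / 2)
    (by positivity) F
  have hZ : ∀ t, psum (max K F) (p - S) t = psum K p t - psum F S t := by
    intro t
    rw [psum_sub, psum_stable K _ (le_max_left _ _) p hp, psum_stable F _ (le_max_right _ _) S hS]
  simp only [hZ] at h1 h3
  have ip : Integrable (psum K p) μ := cont_integrable μ _ (psum_cont _ _)
  have iS : Integrable (psum F S) μ := cont_integrable μ _ (psum_cont _ _)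
  have id' : Integrable (psum F' d) μ := cont_integrable μ _ (psum_cont _ _)
  have j1 : Integrable (fun t => √‖f t - psum K p t‖) μ := int_sqrt μ _ (hf.sub ip)
  have j2 : Integrable (fun t => √‖f t - psum F S t‖) μ := int_sqrt μ _ (hf.sub iS)
  have j3 : Integrable (fun t => √‖psum K p t - psum F S t‖) μ := int_sqrt μ _ (ip.sub iS)
  have j4 : Integrable (fun t => √‖psum K p t - psum F S t - psum F' d t‖) μ :=
    int_sqrt μ _ ((ip.sub iS).sub id')
  have k1 : ∫ t, √‖psum K p t - psum F S t‖ ∂μ ≤ ∫ t, √‖f t - psum F S t‖ ∂μ + ε / 8 := by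
    have := integral_mono j3 (j2.add j1) (fun t => by
      have := sqrt_norm_le (f t - psum F S t) (-(f t - psum K p t))
      rw [norm_neg] at this
      refine le_trans (le_of_eq ?_) this
      congr 2; ring)
    simp only [Pi.add_apply] at this
    rw [integral_add j2 j1] at this
    linarith
  refine ⟨F', hF', d, hd, ?_, η, hη, h2, by linarith⟩
  have hps : ∀ t, psum F' (S + d) t = psum F S t + psum F' d t := by
    intro t; rw [psum_add, psum_stable F F' hF'.le S hS]
  simp only [hps]
  have j5 : Integrable (fun t => √‖f t - (psum F S t + psum F' d t)‖) μ :=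
    int_sqrt μ _ (hf.sub (iS.add id'))
  have := integral_mono j5 (j4.add j1) (fun t => by
      have := sqrt_norm_le (psum K p t - psum F S t - psum F' d t) (f t - psum K p t)
      refine le_trans (le_of_eq ?_) this
      congr 2; ring)
  simp only [Pi.add_apply] at this
  rw [integral_add j4 j1] at this
  nlinarith

lemma ae_tendsto_zero (μ : Measure Circ) (h : ℕ → Circ → ℝ) (h0 : ∀ k t, 0 ≤ h k t)
    (hi : ∀ k, Integrable (h k) μ) (hs : Summable fun k => ∫ t, h k t ∂μ) :
    ∀ᵐ t ∂μ, Tendsto (fun k => h k t) atTop (𝓝 0) := by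
  have hm : ∀ k, AEMeasurable (fun t => ENNReal.ofReal (h k t)) μ :=
    fun k => (hi k).1.aemeasurable.ennreal_ofReal
  have h1 : ∫⁻ t, ∑' k, ENNReal.ofReal (h k t) ∂μ ≠ ⊤ := by
    rw [lintegral_tsum hm]
    have : ∀ k, ∫⁻ t, ENNReal.ofReal (h k t) ∂μ = ENNReal.ofReal (∫ t, h k t ∂μ) := fun k =>
      (ofReal_integral_eq_lintegral_ofReal (hi k) (Eventually.of_forall (h0 k))).symm
    simp only [this]
    rw [← ENNReal.ofReal_tsum_of_nonneg (fun k => integral_nonneg (h0 k)) hs]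
    exact ENNReal.ofReal_ne_top
  filter_upwards [ae_lt_top' (AEMeasurable.tsum hm) h1] with t ht
  have h2 := ENNReal.tendsto_atTop_zero_of_tsum_ne_top ht.ne
  have h3 := (ENNReal.tendsto_toReal ENNReal.zero_ne_top).comp h2
  simp only [ENNReal.toReal_zero] at h3
  refine h3.congr fun k => ?_
  simp [ENNReal.toReal_ofReal (h0 k t)]

lemma summable_contract (x : ℕ → ℝ) (hx : ∀ k, 0 ≤ x k)
    (h : ∀ k, x (k + 1) ≤ (1 - 1 / 6144) * x k + (1 / 2) ^ k) : Summable x := by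
  refine summable_of_sum_range_le (c := 6144 * (x 0 + 2)) hx fun n => ?_
  have key : ∀ n, x n + (1 / 6144) * ∑ k ∈ Finset.range n, x k ≤
      x 0 + ∑ k ∈ Finset.range n, (1 / 2 : ℝ) ^ k := by
    intro n
    induction n with
    | zero => simp
    | succ n ih =>
      rw [Finset.sum_range_succ, Finset.sum_range_succ]
      have := h n
      linarith
  have h2 : ∑ k ∈ Finset.range n, (1 / 2 : ℝ) ^ k ≤ 2 := by
    refine le_trans (summable_geometric_two.sum_le_tsum _ (fun _ _ => by positivity)) ?_
    exact tsum_geometric_two.le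
  have := key n
  have := hx n
  linarith

lemma rich_rep (Λ : Set ℤ) (hΛ : Rich Λ) (μ : Measure Circ) [IsFiniteMeasure μ] (hμ : RLm μ)
    (f : Circ → ℂ) (hf : Integrable f μ) :
    ∃ c : ℤ → ℂ, ∀ᵐ t ∂μ, Tendsto (fun N => menshovPartialSum Λ c N t) atTop (𝓝 (f t)) := by
  let St := {x : ℕ × (ℤ → ℂ) // (∀ n : ℤ, (x.1 : ℤ) < |n| → x.2 n = 0) ∧ ∀ n, x.2 n ≠ 0 → n ∈ Λ}
  have nxt : ∀ (k : ℕ) (x : St), ∃ (y : St) (η : Circ → ℝ), x.1.1 < y.1.1 ∧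
      (∀ n : ℤ, |n| ≤ (x.1.1 : ℤ) → y.1.2 n = x.1.2 n) ∧
      ∫ t, √‖f t - psum y.1.1 y.1.2 t‖ ∂μ ≤
        (1 - 1 / 6144) * ∫ t, √‖f t - psum x.1.1 x.1.2 t‖ ∂μ + (1 / 2) ^ k ∧
      Integrable η μ ∧ (∀ N t, √‖psum N (y.1.2 - x.1.2) t‖ ≤ η t) ∧
        ∫ t, η t ∂μ ≤ 3 * ∫ t, √‖f t - psum x.1.1 x.1.2 t‖ ∂μ + (1 / 2) ^ k := by
    intro k x
    obtain ⟨F', hF', d, hd, h1, η, hη, h2, h3⟩ := step Λ hΛ μ hμ f hf x.1.1 x.1.2 x.2.1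
      ((1 / 2) ^ k) (by positivity)
    refine ⟨⟨(F', x.1.2 + d), ?_, ?_⟩, η, hF', ?_, h1, hη, ?_, h3⟩
    · intro n hn
      have hx := x.2.1 n (lt_trans (by exact_mod_cast hF') hn)
      have hd0 : d n = 0 := by
        by_contra h0
        exact absurd (hd n h0).2.2 (not_le.mpr hn)
      simp [hx, hd0]
    · intro n hn
      by_cases h0 : d n = 0
      · have : x.1.2 n ≠ 0 := by simpa [h0] using hn
        exact x.2.2 n this
      · exact (hd n h0).1
    · intro n hn
      have hd0 : d n = 0 := by
        by_contra h0
        exact absurd (hd n h0).2.1 (not_lt.mpr hn)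
      simp [hd0]
    · intro N t
      have : x.1.2 + d - x.1.2 = d := by simp
      simpa [this] using h2 N t
  choose Y η hlt hsame hcon hηi hηb hηint using nxt
  let x0 : St := ⟨(0, 0), fun _ _ => rfl, fun n hn => absurd rfl hn⟩
  let x : ℕ → St := fun k => Nat.rec x0 (fun k y => Y k y) k
  have hxs : ∀ k, x (k + 1) = Y k (x k) := fun k => rfl
  set F : ℕ → ℕ := fun k => (x k).1.1 with hF
  set S : ℕ → ℤ → ℂ := fun k => (x k).1.2 with hS
  set e : ℕ → Circ → ℝ := fun k => η k (x k) with he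
  have F0 : F 0 = 0 := rfl
  have Fm : StrictMono F := strictMono_nat_of_lt_succ fun k => hlt k (x k)
  have Fk : ∀ k, k ≤ F k := fun k => Fm.le_apply
  have Ssupp : ∀ k (n : ℤ), (F k : ℤ) < |n| → S k n = 0 := fun k => (x k).2.1
  have SΛ : ∀ k n, S k n ≠ 0 → n ∈ Λ := fun k => (x k).2.2
  have Ssame : ∀ k (n : ℤ), |n| ≤ (F k : ℤ) → S (k + 1) n = S k n := fun k => hsame k (x k)
  have Sstab : ∀ k m (n : ℤ), k ≤ m → |n| ≤ (F k : ℤ) → S m n = S k n := by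
    intro k m n hkm hn
    induction m, hkm using Nat.le_induction with
    | base => rfl
    | succ m hm ih =>
      rw [Ssame m n (hn.trans (by exact_mod_cast Fm.monotone hm)), ih]
  have Scon : ∀ k, ∫ t, √‖f t - psum (F (k + 1)) (S (k + 1)) t‖ ∂μ ≤
      (1 - 1 / 6144) * ∫ t, √‖f t - psum (F k) (S k) t‖ ∂μ + (1 / 2) ^ k := fun k => hcon k (x k)
  have ei : ∀ k, Integrable (e k) μ := fun k => hηi k (x k)
  have eb : ∀ k N t, √‖psum N (S (k + 1) - S k) t‖ ≤ e k t := fun k => hηb k (x k)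
  have eint : ∀ k, ∫ t, e k t ∂μ ≤ 3 * ∫ t, √‖f t - psum (F k) (S k) t‖ ∂μ + (1 / 2) ^ k :=
    fun k => hηint k (x k)
  have e0 : ∀ k t, 0 ≤ e k t := fun k t => (Real.sqrt_nonneg _).trans (eb k 0 t)
  have sumA : Summable fun k => ∫ t, √‖f t - psum (F k) (S k) t‖ ∂μ :=
    summable_contract _ (fun k => integral_nonneg fun t => Real.sqrt_nonneg _) Scon
  have sumE : Summable fun k => ∫ t, e k t ∂μ := by
    refine Summable.of_nonneg_of_le (fun k => integral_nonneg (e0 k)) eint ?_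
    exact (sumA.mul_left 3).add summable_geometric_two
  have t1 := ae_tendsto_zero μ (fun k t => √‖f t - psum (F k) (S k) t‖)
    (fun k t => Real.sqrt_nonneg _)
    (fun k => int_sqrt μ _ (hf.sub (cont_integrable μ _ (psum_cont _ _)))) sumA
  have t2 := ae_tendsto_zero μ e e0 ei sumE
  set c : ℤ → ℂ := fun n => S n.natAbs n with hc
  have cS : ∀ k (n : ℤ), |n| ≤ (F k : ℤ) → c n = S k n := by
    intro k n hn
    rw [hc]
    dsimp only
    have hself : |n| ≤ (F n.natAbs : ℤ) := by
      rw [← Int.natCast_natAbs]; exact_mod_cast Fk _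
    rcases le_total k n.natAbs with h | h
    · exact Sstab k _ n h hn
    · exact (Sstab _ k n h hself).symm
  have cΛ : ∀ n, Λ.indicator c n = c n := by
    intro n
    by_cases hn : n ∈ Λ
    · rw [Set.indicator_of_mem hn]
    · rw [Set.indicator_of_notMem hn]
      by_contra h0
      exact hn (SΛ _ n (Ne.symm h0))
  refine ⟨c, ?_⟩
  filter_upwards [t1, t2] with t h1 h2
  rw [Metric.tendsto_atTop]
  intro ε hε
  have hs : 0 < √(ε / 2) := Real.sqrt_pos.mpr (by positivity)
  obtain ⟨k0, hk0⟩ := Filter.eventually_atTop.mp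
    ((h1.eventually (gt_mem_nhds hs)).and (h2.eventually (gt_mem_nhds hs)))
  refine ⟨F k0, fun N hN => ?_⟩
  obtain ⟨k, hk1, hk2⟩ : ∃ k, F k ≤ N ∧ N < F (k + 1) := by
    have hex : ∃ k, N < F k := ⟨N + 1, lt_of_lt_of_le (Nat.lt_succ_self N) (Fk _)⟩
    have hsp := Nat.find_spec hex
    have hmin := fun m => Nat.find_min hex (m := m)
    obtain ⟨j, hj⟩ : ∃ j, Nat.find hex = j + 1 := by
      refine Nat.exists_eq_succ_of_ne_zero fun h0 => ?_
      rw [h0, F0] at hsp; omega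
    refine ⟨j, not_lt.mp (hmin j (by omega)), by rwa [hj] at hsp⟩
  have hkk : k0 ≤ k := by
    have : F k0 < F (k + 1) := lt_of_le_of_lt hN hk2
    by_contra hcon
    have h4 : k + 1 ≤ k0 := by omega
    have h3 : F (k + 1) ≤ F k0 := by
      have hm := Fm.monotone
      exact hm h4
    omega
  obtain ⟨b1, b2⟩ := hk0 k hkk
  have p1 : menshovPartialSum Λ c N t = psum (F k) (S k) t + psum N (S (k + 1) - S k) t := by
    rw [← psum_stable (F k) N hk1 (S k) (Ssupp k), ← psum_add, add_sub_cancel]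
    unfold menshovPartialSum psum
    refine Finset.sum_congr rfl fun n hn => ?_
    rw [cΛ, cS (k + 1)]
    have := abs_le.mpr (Finset.mem_Icc.mp hn)
    exact this.trans (by exact_mod_cast hk2.le)
  have q1 : ‖f t - psum (F k) (S k) t‖ < ε / 2 := (Real.sqrt_lt_sqrt_iff (norm_nonneg _)).mp b1
  have q2 : ‖psum N (S (k + 1) - S k) t‖ < ε / 2 :=
    (Real.sqrt_lt_sqrt_iff (norm_nonneg _)).mp (lt_of_le_of_lt (eb k N t) b2)
  rw [p1, dist_eq_norm]
  have : psum (F k) (S k) t + psum N (S (k + 1) - S k) t - f t =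
      psum N (S (k + 1) - S k) t - (f t - psum (F k) (S k) t) := by ring
  rw [this]
  exact lt_of_le_of_lt (norm_sub_le _ _) (by linarith)

lemma rich_menshov (Λ : Set ℤ) (hΛ : Rich Λ) : IsMenshovSpectrum Λ := by
  intro f hf
  let g : Circ → NNReal := fun t => (1 + ‖f t‖₊)⁻¹
  have hg : Measurable g := (hf.nnnorm.const_add 1).inv
  have hg1 : ∀ t, g t ≤ 1 := by
    intro t
    exact inv_le_one_of_one_le₀ (le_add_of_nonneg_right zero_le)
  set μ : Measure Circ := volume.withDensity fun t => (g t : ENNReal) with hμ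
  have hfin : IsFiniteMeasure μ := by
    refine isFiniteMeasure_withDensity (ne_of_lt ?_)
    refine lt_of_le_of_lt (lintegral_mono (g := fun _ => 1) fun t => ?_) ?_
    · change (g t : ENNReal) ≤ 1
      exact_mod_cast hg1 t
    · simp [ENNReal.mul_lt_top]
  have hfi : Integrable f μ := by
    rw [hμ, integrable_withDensity_iff_integrable_smul hg]
    refine Integrable.of_bound (C := 1) (by fun_prop) (Eventually.of_forall fun t => ?_)
    rw [NNReal.smul_def, norm_smul]
    simp only [g]
    rw [NNReal.norm_eq]
    push_cast
    rw [inv_mul_le_one₀ (by positivity)]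
    linarith
  obtain ⟨c, hc⟩ := rich_rep Λ hΛ μ (rlm_withDensity g hg) f hfi
  refine ⟨c, ?_⟩
  have hac : (volume : Measure Circ) ≪ μ := by
    refine withDensity_absolutelyContinuous' (by fun_prop) (Eventually.of_forall fun t => ?_)
    simp [g]
  exact hac.ae_le hc

lemma IsBlock.weaken {L : ℕ} {κ κ' : ℝ} {J : ℕ} {σ : ℕ → ℝ} {β : ℕ → ℕ} {ξ : C(Circ, ℝ)}
    (h : IsBlock L κ J σ β ξ) (hk : κ ≤ κ') : IsBlock L κ' J σ β ξ :=
  { h with xint := h.xint.trans hk }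

lemma construct (w : ℕ → ℝ) (hw : Tendsto w atTop atTop) :
    ∃ a : ℕ → ℤ, Tendsto (fun k => |(a k : ℝ) - (k : ℝ) ^ 2| / w k) atTop (𝓝 0) ∧
      ∀ (L : ℕ) (κ : ℝ), 0 < κ → ∃ J σ β ξ, ∃ r : ℕ → ℕ,
      IsBlock (L + 1) κ J σ β ξ ∧ (∀ n, 2 ^ L < r n) ∧ (∀ n, r n + J + 1 ≤ r (n + 1)) ∧
      ∀ n, ∀ j < J, lam (2 ^ L) (r n) β j = a (r n + j) := by
  have hbl : ∀ L k : ℕ, ∃ J σ β ξ, IsBlock (L + 1) (1 / ((k : ℝ) + 1)) J σ β ξ := fun L k =>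
    block_exists (L + 1) _ (by positivity)
  choose J σ β ξ HB using hbl
  let tL : ℕ → ℕ := fun i => (Nat.unpair (Nat.unpair i).1).1
  let tk : ℕ → ℕ := fun i => (Nat.unpair (Nat.unpair i).1).2
  let Ji : ℕ → ℕ := fun i => J (tL i) (tk i)
  let βi : ℕ → ℕ → ℕ := fun i => β (tL i) (tk i)
  have hth : ∀ i, ∃ m : ℕ, 2 ^ tL i < m ∧
      ∀ k, m ≤ k → ((i : ℝ) + 1) * ((Ji i : ℝ) ^ 2 + 2 ^ tL i) ≤ w k := by
    intro i
    obtain ⟨m, hm⟩ := Filter.eventually_atTop.mp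
      (hw.eventually_ge_atTop (((i : ℝ) + 1) * ((Ji i : ℝ) ^ 2 + 2 ^ tL i)))
    exact ⟨max m (2 ^ tL i + 1), lt_of_lt_of_le (Nat.lt_succ_self _) (le_max_right _ _),
      fun k hk => hm k ((le_max_left _ _).trans hk)⟩
  choose th hth1 hth2 using hth
  let r : ℕ → ℕ := fun i => Nat.rec (th 0) (fun i ri => max (th (i + 1)) (ri + Ji i + 1)) i
  have hrs : ∀ i, r (i + 1) = max (th (i + 1)) (r i + Ji i + 1) := fun i => rfl
  have hrth : ∀ i, th i ≤ r i := by
    intro i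
    cases i with
    | zero => exact le_rfl
    | succ i => rw [hrs]; exact le_max_left _ _
  have hrJ : ∀ i, r i + Ji i + 1 ≤ r (i + 1) := fun i => by rw [hrs]; exact le_max_right _ _
  have hrm : Monotone r := monotone_nat_of_le_succ fun i => by have := hrJ i; omega
  have hrlt : ∀ i j, i < j → r i + Ji i + 1 ≤ r j := fun i j hij => (hrJ i).trans (hrm hij)
  have huniq : ∀ i i' k, r i ≤ k → k < r i + Ji i → r i' ≤ k → k < r i' + Ji i' → i = i' := by
    intro i i' k h1 h2 h3 h4
    rcases lt_trichotomy i i' with h | h | h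
    · have := hrlt i i' h; omega
    · exact h
    · have := hrlt i' i h; omega
  have hav : ∀ k : ℕ, ∃ z : ℤ,
      (∀ i : ℕ, r i ≤ k → k < r i + Ji i → z = lam (2 ^ tL i) (r i) (βi i) (k - r i)) ∧
      ((¬ ∃ i : ℕ, r i ≤ k ∧ k < r i + Ji i) → z = (k : ℤ) ^ 2) := by
    intro k
    rcases Classical.em (∃ i : ℕ, r i ≤ k ∧ k < r i + Ji i) with hex | hex
    · obtain ⟨i, h1, h2⟩ := hex
      refine ⟨lam (2 ^ tL i) (r i) (βi i) (k - r i), fun i' h3 h4 => ?_,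
        fun hn => absurd ⟨i, h1, h2⟩ hn⟩
      rw [huniq i i' k h1 h2 h3 h4]
    · exact ⟨(k : ℤ) ^ 2, fun i h1 h2 => absurd ⟨i, h1, h2⟩ hex, fun _ => rfl⟩
  choose a haa ha2 using hav
  have ha1 : ∀ i j, j < Ji i → a (r i + j) = lam (2 ^ tL i) (r i) (βi i) j := by
    intro i j hj
    rw [haa (r i + j) i (by omega) (by omega), Nat.add_sub_cancel_left]
  refine ⟨a, ?_, ?_⟩
  · rw [Metric.tendsto_atTop]
    intro ε hε
    obtain ⟨i0, hi0⟩ := exists_nat_one_div_lt hε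
    refine ⟨r i0, fun k hk => ?_⟩
    rw [Real.dist_eq, sub_zero]
    rcases Classical.em (∃ i : ℕ, r i ≤ k ∧ k < r i + Ji i) with hex | hex
    · obtain ⟨i, h1, h2⟩ := hex
      obtain ⟨j, rfl⟩ := Nat.exists_eq_add_of_le h1
      have hj : j < Ji i := by omega
      have hii : i0 ≤ i := by
        by_contra hcon
        have := hrlt i i0 (by omega)
        omega
      have hwk := hth2 i (r i + j) ((hrth i).trans h1)
      set V : ℝ := (Ji i : ℝ) ^ 2 + 2 ^ tL i with hV
      have hVpos : 0 < V := by positivity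
      have hwpos : 0 < w (r i + j) := lt_of_lt_of_le (by positivity) hwk
      have hnum : |(a (r i + j) : ℝ) - ((r i + j : ℕ) : ℝ) ^ 2| ≤ V := by
        rw [ha1 i j hj]
        have e : ((lam (2 ^ tL i) (r i) (βi i) j : ℤ) : ℝ) - ((r i + j : ℕ) : ℝ) ^ 2 =
            (βi i j : ℝ) - 2 ^ tL i - (j : ℝ) ^ 2 := by
          unfold lam; push_cast; ring
        rw [e]
        have hb : (βi i j : ℝ) < 2 ^ (tL i + 1) := by exact_mod_cast (HB (tL i) (tk i)).bet j
        rw [pow_succ] at hb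
        have hb0 : (0 : ℝ) ≤ βi i j := Nat.cast_nonneg _
        have hj2 : (j : ℝ) ^ 2 ≤ (Ji i : ℝ) ^ 2 := by
          have : (j : ℝ) ≤ Ji i := by exact_mod_cast hj.le
          gcongr
        have : (0 : ℝ) ≤ (j : ℝ) ^ 2 := by positivity
        rw [abs_le]
        constructor <;> linarith
      rw [abs_of_nonneg (by positivity)]
      refine lt_of_le_of_lt ?_ hi0
      rw [div_le_div_iff₀ hwpos (by positivity), one_mul]
      have hi : ((i0 : ℝ) + 1) ≤ (i : ℝ) + 1 := by
        have : (i0 : ℝ) ≤ i := by exact_mod_cast hii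
        linarith
      calc _ ≤ V * ((i : ℝ) + 1) := by gcongr
        _ ≤ _ := by linarith
    · rw [ha2 k hex]
      simpa using hε
  · intro L κ hκ
    obtain ⟨k, hk⟩ := exists_nat_one_div_lt hκ
    let φ : ℕ → ℕ := fun n => Nat.pair (Nat.pair L k) n
    have hL : ∀ n, tL (φ n) = L := by intro n; simp [tL, φ]
    have hkk : ∀ n, tk (φ n) = k := by intro n; simp [tk, φ]
    have hJ : ∀ n, Ji (φ n) = J L k := by intro n; simp only [Ji, hL, hkk]
    have hβ : ∀ n, βi (φ n) = β L k := by intro n; simp only [βi, hL, hkk]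
    refine ⟨J L k, σ L k, β L k, ξ L k, fun n => r (φ n), (HB L k).weaken hk.le, ?_, ?_, ?_⟩
    · intro n
      have := (hth1 (φ n)).trans_le (hrth (φ n))
      rwa [hL] at this
    · intro n
      have := hrlt (φ n) (φ (n + 1)) (Nat.pair_lt_pair_right _ (Nat.lt_succ_self n))
      rwa [hJ] at this
    · intro n j hj
      have := ha1 (φ n) j (by rwa [hJ])
      rw [this, hL, hβ]

theorem menshov_spectrum_perturbed_squares (w : ℕ → ℝ) (hwpos : ∀ k, 0 < w k)
    (hw : Tendsto w atTop atTop) :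
    ∃ a b : ℕ → ℤ,
      Tendsto (fun k => (|a k - (k : ℤ) ^ 2| : ℝ) / w k) atTop (𝓝 0) ∧
      Tendsto (fun k => (|b k + (k : ℤ) ^ 2| : ℝ) / w k) atTop (𝓝 0) ∧
      IsMenshovSpectrum (a '' {k : ℕ | 1 ≤ k} ∪ b '' {k : ℕ | 1 ≤ k}) := by
  obtain ⟨a, ha, hrich⟩ := construct w hw
  refine ⟨a, fun k => -a k, ?_, ?_, ?_⟩
  · refine ha.congr fun k => ?_
    push_cast
    rfl
  · refine ha.congr fun k => ?_
    push_cast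
    rw [← abs_neg, neg_sub, sub_eq_neg_add]
  · apply rich_menshov
    intro L κ hκ
    obtain ⟨J, σ, β, ξ, r, HB, h1, h2, h3⟩ := hrich L κ hκ
    refine ⟨J, σ, β, ξ, r, HB, h1, h2, fun n j hj => ?_⟩
    have hpos : 1 ≤ r n + j := by
      have := h1 n
      have h5 : 0 < 2 ^ L := by positivity
      omega
    rw [h3 n j hj]
    exact ⟨Or.inl ⟨r n + j, hpos, rfl⟩, Or.inr ⟨r n + j, hpos, rfl⟩⟩
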